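/- (Home-flow inequalities) For every team t ∈ V and every slot k ∈ {1,…,n−1}, each of the following four inequalities is facet-defining for Ptt(n): (a) Σ_{j ∈ V∖{t}} y_{t,t,j} + Σ_{j ∈ V∖{t}} (x_{k,t,j} + x_{k+n−1,t,j}) ≥ 2; (b) Σ_{j ∈ V∖{t}} y_{t,t,j} + Σ_{j ∈ V∖{t}} (x_{k,j,t} + x_{k+n−1,j,t}) ≥ 2; (c) Σ_{i ∈ V∖{t}} y_{t,i,t} + Σ_{i ∈ V∖{t}} (x_{k,t,i} + x_{k+n−1,t,i}) ≥ 2; (d) Σ_{i ∈ V∖{t}} y_{t,i,t} + Σ_{i ∈ V∖{t}} (x_{k,i,t} + x_{k+n−1,i,t}) ≥ 2. -/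

import Mathlib

open Finset

attribute [local instance] Classical.propDecidable

namespace TTP

/-- `(k,i,j)` is a valid match index: slot `k ∈ S = {1,…,2n-2}`, home venue `i` and
away team `j` are distinct elements of `V = {1,…,n}`. -/
def IsMatch (n : ℕ) (m : ℕ × ℕ × ℕ) : Prop :=
  1 ≤ m.1 ∧ m.1 ≤ 2 * n - 2 ∧ 1 ≤ m.2.1 ∧ m.2.1 ≤ n ∧ 1 ≤ m.2.2 ∧ m.2.2 ≤ n ∧ m.2.1 ≠ m.2.2

/-- `(t,i,j)` is a valid travel index: `t ∈ V` and `(i,j) ∈ A`. -/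
def IsTravelIdx (n : ℕ) (p : ℕ × ℕ × ℕ) : Prop :=
  1 ≤ p.1 ∧ p.1 ≤ n ∧ 1 ≤ p.2.1 ∧ p.2.1 ≤ n ∧ 1 ≤ p.2.2 ∧ p.2.2 ≤ n ∧ p.2.1 ≠ p.2.2

/-- A (double round-robin) tournament: a set of matches such that in every slot every team
plays exactly once, and every ordered pair of distinct teams meets exactly once. -/
structure IsTournament (n : ℕ) (T : Set (ℕ × ℕ × ℕ)) : Prop where
  subset : ∀ m ∈ T, IsMatch n m
  slot_team : ∀ k, 1 ≤ k → k ≤ 2 * n - 2 → ∀ t, 1 ≤ t → t ≤ n →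
      ∃! m : ℕ × ℕ × ℕ, m ∈ T ∧ m.1 = k ∧ (t = m.2.1 ∨ t = m.2.2)
  pair : ∀ i j, 1 ≤ i → i ≤ n → 1 ≤ j → j ≤ n → i ≠ j → ∃! k : ℕ, (k, i, j) ∈ T

/-- The venue of team `t` in slot `k`: the home venue of the (unique) match of `t` in
slot `k`, and `t` itself if `t` has no match in slot `k` (in particular in the artificial
slots `0` and `2n-1`). -/
noncomputable def venue (T : Set (ℕ × ℕ × ℕ)) (t k : ℕ) : ℕ :=
  if h : ∃ i, ∃ j, (k, i, j) ∈ T ∧ (t = i ∨ t = j) then h.choose else t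

/-- The travel vector `ψ(T)`: `travel n T (t,i,j) = 1` iff for some `0 ≤ k ≤ 2n-2` team `t`
has venue `i` in slot `k` and venue `j` in slot `k+1`. -/
noncomputable def travel (n : ℕ) (T : Set (ℕ × ℕ × ℕ)) (p : ℕ × ℕ × ℕ) : ℝ :=
  if ∃ k, k ≤ 2 * n - 2 ∧ venue T p.1 k = p.2.1 ∧ venue T p.1 (k + 1) = p.2.2 then 1 else 0

/-- The play vector `χ(T)`: characteristic vector of `T`. -/
noncomputable def play (T : Set (ℕ × ℕ × ℕ)) (m : ℕ × ℕ × ℕ) : ℝ :=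
  if m ∈ T then 1 else 0

/-- The ambient space `ℝ^M × ℝ^{V×A}`. -/
abbrev Pt (n : ℕ) :=
  ({m : ℕ × ℕ × ℕ // IsMatch n m} → ℝ) × ({p : ℕ × ℕ × ℕ // IsTravelIdx n p} → ℝ)

/-- The play coordinate `x_{k,i,j}` of a point (0 at invalid indices). -/
noncomputable def xval {n : ℕ} (z : Pt n) (k i j : ℕ) : ℝ :=
  if h : IsMatch n (k, i, j) then z.1 ⟨(k, i, j), h⟩ else 0

/-- The travel coordinate `y_{t,i,j}` of a point (0 at invalid indices). -/
noncomputable def yval {n : ℕ} (z : Pt n) (t i j : ℕ) : ℝ :=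
  if h : IsTravelIdx n (t, i, j) then z.2 ⟨(t, i, j), h⟩ else 0

/-- The unconstrained traveling tournament polytope `Ptt(n)`:
the convex hull of all pairs `(χ(T), y)` with `T` a tournament and `y ∈ {0,1}^{V×A}`,
`y ≥ ψ(T)` componentwise. -/
def Ptt (n : ℕ) : Set (Pt n) :=
  convexHull ℝ { z : Pt n | ∃ T : Set (ℕ × ℕ × ℕ), IsTournament n T ∧
    (∀ m : {m : ℕ × ℕ × ℕ // IsMatch n m}, z.1 m = play T m.1) ∧
    (∀ p : {p : ℕ × ℕ × ℕ // IsTravelIdx n p}, z.2 p = 0 ∨ z.2 p = 1) ∧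
    (∀ p : {p : ℕ × ℕ × ℕ // IsTravelIdx n p}, travel n T p.1 ≤ z.2 p) }

/-- Dimension of the affine hull of a set. -/
noncomputable def adim {n : ℕ} (s : Set (Pt n)) : ℕ :=
  Module.finrank ℝ (affineSpan ℝ s).direction

/-- A valid inequality `f z ≤ γ` is facet-defining for `Ptt(n)`:
it holds on `Ptt(n)` and its face has dimension `dim Ptt(n) - 1`. -/
def IsFacetLE {n : ℕ} (f : Pt n → ℝ) (γ : ℝ) : Prop :=
  (∀ z ∈ Ptt n, f z ≤ γ) ∧ adim {z ∈ Ptt n | f z = γ} + 1 = adim (Ptt n)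

/-- A valid inequality `f z ≥ γ` is facet-defining for `Ptt(n)`:
it holds on `Ptt(n)` and its face has dimension `dim Ptt(n) - 1`. -/
def IsFacetGE {n : ℕ} (f : Pt n → ℝ) (γ : ℝ) : Prop :=
  (∀ z ∈ Ptt n, γ ≤ f z) ∧ adim {z ∈ Ptt n | f z = γ} + 1 = adim (Ptt n)

/-- `F` is a one-factorization of the complete graph on `{1,…,n}` with colours `{0,…,n-2}`:
`F c i` is the partner of `i` in the perfect matching of colour `c`. -/
structure OneFac (n : ℕ) (F : ℕ → ℕ → ℕ) : Prop where
  mem : ∀ {c i}, c < n - 1 → i ∈ Icc 1 n → F c i ∈ Icc 1 n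
  ne : ∀ {c i}, c < n - 1 → i ∈ Icc 1 n → F c i ≠ i
  inv : ∀ {c i}, c < n - 1 → i ∈ Icc 1 n → F c (F c i) = i
  ex : ∀ {i j}, i ∈ Icc 1 n → j ∈ Icc 1 n → i ≠ j → ∃ c < n - 1, F c i = j
  uniq : ∀ {c d i}, c < n - 1 → d < n - 1 → i ∈ Icc 1 n → F c i = F d i → c = d

/-- The canonical one-factorization: on `{1,…,n-1}` the colour of an edge is the sum of its
ends modulo `n-1`, and `n` is joined to `i` in the colour `2i`. -/
def canonFac (n c i : ℕ) : ℕ :=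
  if i = n then (if c = 0 then n - 1 else if c % 2 = 0 then c / 2 else (c + n - 1) / 2)
  else if i + i = c ∨ i + i = c + (n - 1) ∨ i + i = c + 2 * (n - 1) then n
  else if i < c then c - i else if i < c + (n - 1) then c + (n - 1) - i else c + 2 * (n - 1) - i

theorem canonFac_eq_iff {n c i j : ℕ} (hn : 4 ≤ n) (he : Even n) (hc : c < n - 1)
    (hi : i ∈ Icc 1 n) (hj : j ∈ Icc 1 n) :
    canonFac n c i = j ↔ i ≠ j ∧
      ((i = n ∧ (j + j = c ∨ j + j = c + (n - 1) ∨ j + j = c + 2 * (n - 1))) ∨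
      (j = n ∧ (i + i = c ∨ i + i = c + (n - 1) ∨ i + i = c + 2 * (n - 1))) ∨
      (i ≠ n ∧ j ≠ n ∧ (i + j = c ∨ i + j = c + (n - 1) ∨ i + j = c + 2 * (n - 1)))) := by
  obtain ⟨r, rfl⟩ := he
  rw [Finset.mem_Icc] at hi hj
  unfold canonFac
  split_ifs <;> omega

theorem canonFac_mem {n c i : ℕ} (hn : 4 ≤ n) (he : Even n) (hc : c < n - 1)
    (hi : i ∈ Icc 1 n) : canonFac n c i ∈ Icc 1 n := by
  obtain ⟨r, rfl⟩ := he
  rw [Finset.mem_Icc] at hi ⊢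
  unfold canonFac
  split_ifs <;> omega

theorem oneFac_canonFac {n : ℕ} (hn : 4 ≤ n) (he : Even n) : OneFac n (canonFac n) where
  mem := canonFac_mem hn he
  ne {c i} hc hi h := ((canonFac_eq_iff hn he hc hi hi).1 h).1 rfl
  inv {c i} hc hi := by
    have hm := canonFac_mem hn he hc hi
    have h1 := (canonFac_eq_iff hn he hc hi hm).1 rfl
    rw [canonFac_eq_iff hn he hc hm hi]
    omega
  ex {i j} hi hj hij := by
    have hi' := Finset.mem_Icc.1 hi
    have hj' := Finset.mem_Icc.1 hj
    have key : ∃ c < n - 1, i ≠ j ∧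
      ((i = n ∧ (j + j = c ∨ j + j = c + (n - 1) ∨ j + j = c + 2 * (n - 1))) ∨
      (j = n ∧ (i + i = c ∨ i + i = c + (n - 1) ∨ i + i = c + 2 * (n - 1))) ∨
      (i ≠ n ∧ j ≠ n ∧ (i + j = c ∨ i + j = c + (n - 1) ∨ i + j = c + 2 * (n - 1)))) := by
      let e := if i = n then j + j else if j = n then i + i else i + j
      refine ⟨if e < n - 1 then e else if e < 2 * (n - 1) then e - (n - 1)
        else e - 2 * (n - 1), ?_, hij, ?_⟩
      · simp only [e]; split_ifs <;> omega
      · simp only [e]; split_ifs <;> omega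
    obtain ⟨c, hc, h⟩ := key
    exact ⟨c, hc, (canonFac_eq_iff hn he hc hi hj).2 h⟩
  uniq {c d i} hc hd hi h := by
    have hm := canonFac_mem hn he hd hi
    have h1 := (canonFac_eq_iff hn he hc hi hm).1 h
    have h2 := (canonFac_eq_iff hn he hd hi hm).1 rfl
    rw [Finset.mem_Icc] at hi hm
    omega

/-- Relabelling the teams by exchanging `x` and `y`. -/
theorem OneFac.swap {n : ℕ} {F : ℕ → ℕ → ℕ} (h : OneFac n F) {x y : ℕ} (hx : x ∈ Icc 1 n)
    (hy : y ∈ Icc 1 n) :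
    OneFac n (fun c i => Equiv.swap x y (F c (Equiv.swap x y i))) := by
  have hs : ∀ {i}, i ∈ Icc 1 n → Equiv.swap x y i ∈ Icc 1 n := by
    intro i hi
    rw [Equiv.swap_apply_def]
    split_ifs <;> assumption
  refine ⟨fun hc hi => hs (h.mem hc (hs hi)), fun hc hi he => ?_, fun hc hi => ?_,
    fun {i j} hi hj hij => ?_, fun hc hd hi he => ?_⟩
  · exact h.ne hc (hs hi) (by rw [Equiv.swap_apply_eq_iff] at he; exact he)
  · simp only [Equiv.swap_apply_self]
    rw [h.inv hc (hs hi), Equiv.swap_apply_self]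
  · obtain ⟨c, hc, hF⟩ := h.ex (hs hi) (hs hj) (fun e => hij ((Equiv.swap x y).injective e))
    exact ⟨c, hc, by simp only [hF, Equiv.swap_apply_self]⟩
  · exact h.uniq hc hd (hs hi) ((Equiv.swap x y).injective he)

/-- An orientation of the complete graph on `{1,…,n}` in which `t` beats everybody. -/
structure Orient (t : ℕ) (R : ℕ → ℕ → Prop) : Prop where
  tot : ∀ {i j}, i ≠ j → (R i j ↔ ¬ R j i)
  top : ∀ {j}, j ≠ t → R t j

/-- `H` is a set of slots such that `σ` maps both `H` and its complement bijectively onto the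
set of colours. -/
structure Sched (n : ℕ) (H : Finset ℕ) (σ : ℕ → ℕ) : Prop where
  sub : H ⊆ Icc 1 (2 * n - 2)
  home : Set.BijOn σ H (Set.Iio (n - 1))
  away : Set.BijOn σ ↑(Icc 1 (2 * n - 2) \ H) (Set.Iio (n - 1))

theorem Sched.lt {n : ℕ} {H : Finset ℕ} {σ : ℕ → ℕ} (h : Sched n H σ) {p : ℕ}
    (hp : p ∈ Icc 1 (2 * n - 2)) : σ p < n - 1 := by
  by_cases hH : p ∈ H
  · exact h.home.1 hH
  · exact h.away.1 (by simpa [hH] using hp)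

/-- The double round-robin tournament in which slot `p` carries the matching of colour `σ p`,
oriented along `R` for `p ∈ H` and against `R` otherwise. -/
def tour (n : ℕ) (F : ℕ → ℕ → ℕ) (R : ℕ → ℕ → Prop) (H : Finset ℕ) (σ : ℕ → ℕ) :
    Set (ℕ × ℕ × ℕ) :=
  {m | m.1 ∈ Icc 1 (2 * n - 2) ∧ m.2.1 ∈ Icc 1 n ∧ m.2.2 = F (σ m.1) m.2.1 ∧
    (m.1 ∈ H ↔ R m.2.1 m.2.2)}

theorem mem_tour {n : ℕ} {F : ℕ → ℕ → ℕ} {R : ℕ → ℕ → Prop} {H : Finset ℕ} {σ : ℕ → ℕ}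
    {p i j : ℕ} : (p, i, j) ∈ tour n F R H σ ↔ p ∈ Icc 1 (2 * n - 2) ∧ i ∈ Icc 1 n ∧
      j = F (σ p) i ∧ (p ∈ H ↔ R i j) := Iff.rfl

theorem isTournament_tour {n t : ℕ} {F : ℕ → ℕ → ℕ} {R : ℕ → ℕ → Prop} {H : Finset ℕ}
    {σ : ℕ → ℕ} (hF : OneFac n F) (hR : Orient t R) (hσ : Sched n H σ) :
    IsTournament n (tour n F R H σ) := by
  refine ⟨?_, ?_, ?_⟩
  · rintro ⟨p, i, j⟩ ⟨hp, hi, hj, -⟩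
    have hc := hσ.lt hp
    have hm := hF.mem hc hi
    have hne := hF.ne hc hi
    simp only at hp hi hj
    rw [← hj] at hm hne
    rw [Finset.mem_Icc] at hp hi hm
    exact ⟨hp.1, hp.2, hi.1, hi.2, hm.1, hm.2, hne.symm⟩
  · intro p hp1 hp2 s hs1 hs2
    have hp : p ∈ Icc 1 (2 * n - 2) := Finset.mem_Icc.2 ⟨hp1, hp2⟩
    have hs : s ∈ Icc 1 n := Finset.mem_Icc.2 ⟨hs1, hs2⟩
    have hc := hσ.lt hp
    have hne := hF.ne hc hs
    have htot := hR.tot hne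
    have hinv := hF.inv hc hs
    by_cases h : p ∈ H ↔ R s (F (σ p) s)
    · refine ⟨(p, s, F (σ p) s), ⟨mem_tour.2 ⟨hp, hs, rfl, h⟩, rfl, Or.inl rfl⟩, ?_⟩
      rintro ⟨q, i, j⟩ ⟨⟨-, hi, hj, ho⟩, hq, hsij⟩
      simp only at hi hj ho hq hsij
      subst hq
      rcases hsij with rfl | rfl
      · rw [hj]
      · have : F (σ q) s = i := by rw [hj, hF.inv hc hi]
        rw [this] at h htot
        tauto
    · refine ⟨(p, F (σ p) s, s), ⟨mem_tour.2 ⟨hp, hF.mem hc hs, hinv.symm, by tauto⟩, rfl,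
        Or.inr rfl⟩, ?_⟩
      rintro ⟨q, i, j⟩ ⟨⟨-, hi, hj, ho⟩, hq, hsij⟩
      simp only at hi hj ho hq hsij
      subst hq
      rcases hsij with rfl | rfl
      · rw [← hj] at h; exact absurd ho h
      · rw [hj, hF.inv hc hi]
  · intro i j hi1 hi2 hj1 hj2 hij
    have hi : i ∈ Icc 1 n := Finset.mem_Icc.2 ⟨hi1, hi2⟩
    have hj : j ∈ Icc 1 n := Finset.mem_Icc.2 ⟨hj1, hj2⟩
    obtain ⟨c, hc, hFc⟩ := hF.ex hi hj hij
    by_cases h : R i j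
    · obtain ⟨p, hp, hpc⟩ := hσ.home.2.2 hc
      have hp' := hσ.sub hp
      refine ⟨p, mem_tour.2 ⟨hp', hi, by rw [hpc, hFc], iff_of_true hp h⟩, ?_⟩
      rintro q ⟨hq, -, hqj, hqo⟩
      simp only at hq hqj hqo
      refine hσ.home.2.1 (hqo.2 h) hp ?_
      rw [hpc]
      exact hF.uniq (hσ.lt hq) hc hi (by rw [← hqj, hFc])
    · obtain ⟨p, hp, hpc⟩ := hσ.away.2.2 hc
      have hp' := Finset.mem_sdiff.1 hp
      refine ⟨p, mem_tour.2 ⟨hp'.1, hi, by rw [hpc, hFc], iff_of_false hp'.2 h⟩, ?_⟩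
      rintro q ⟨hq, -, hqj, hqo⟩
      simp only at hq hqj hqo
      refine hσ.away.2.1 (Finset.mem_coe.2 (Finset.mem_sdiff.2 ⟨hq, fun h' => h (hqo.1 h')⟩)) hp ?_
      rw [hpc]
      exact hF.uniq (hσ.lt hq) hc hi (by rw [← hqj, hFc])

/-- Every set of `n - 1` slots carries a schedule with two prescribed colours in `H` and two
prescribed colours off `H`. -/
theorem exists_bijOn_two {A : Finset ℕ} {m : ℕ} (hA : A.card = m) {p q c d : ℕ} (hp : p ∈ A)
    (hq : q ∈ A) (hc : c < m) (hd : d < m) (hpq : p = q ↔ c = d) :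
    ∃ f : ℕ → ℕ, Set.BijOn f A (Set.Iio m) ∧ f p = c ∧ f q = d := by
  obtain ⟨f, hf⟩ : ∃ f : ℕ → ℕ, Set.BijOn f A (Set.Iio m) := by
    have : (A : Set ℕ).encard = (Set.Iio m).encard := by
      rw [← Finset.coe_range, Set.encard_coe_eq_coe_finsetCard, Set.encard_coe_eq_coe_finsetCard,
        hA, Finset.card_range]
    obtain ⟨f, hf⟩ := Set.Finite.exists_bijOn_of_encard_eq A.finite_toSet this
    exact ⟨f, hf⟩
  have hsw : ∀ {x y : ℕ}, x < m → y < m →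
      Set.BijOn (Equiv.swap x y) (Set.Iio m) (Set.Iio m) := by
    intro x y hx hy
    have hmap : Set.MapsTo (Equiv.swap x y) (Set.Iio m) (Set.Iio m) := by
      intro z hz
      rw [Equiv.swap_apply_def]
      split_ifs
      · exact hy
      · exact hx
      · exact hz
    refine ⟨hmap, (Equiv.swap x y).injective.injOn, fun z hz => ⟨_, hmap hz, ?_⟩⟩
    exact Equiv.swap_apply_self _ _ _
  have h1 := (hsw (hf.1 hp) hc).comp hf
  set g := Equiv.swap (f p) c ∘ f with hg
  have hgp : g p = c := by simp [hg]
  have h2 := (hsw (h1.1 hq) hd).comp h1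
  refine ⟨_, h2, ?_, by simp⟩
  by_cases h : p = q
  · subst h; simp [hpq.1 rfl]
  · have : c ≠ g q := fun e => h (h1.2.1 hp hq (by rw [hgp, e]))
    have : c ≠ d := fun e => h (hpq.2 e)
    simp only [Function.comp, hgp]
    exact Equiv.swap_apply_of_ne_of_ne ‹c ≠ g q› ‹c ≠ d›

theorem exists_sched {n : ℕ} (hn : 4 ≤ n) {H : Finset ℕ} (hH : H ⊆ Icc 1 (2 * n - 2))
    (hcard : H.card = n - 1) {p p' c c' q q' d d' : ℕ} (hp : p ∈ H) (hp' : p' ∈ H)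
    (hc : c < n - 1) (hc' : c' < n - 1) (hpp : p = p' ↔ c = c')
    (hq : q ∈ Icc 1 (2 * n - 2) \ H) (hq' : q' ∈ Icc 1 (2 * n - 2) \ H)
    (hd : d < n - 1) (hd' : d' < n - 1) (hqq : q = q' ↔ d = d') :
    ∃ σ, Sched n H σ ∧ σ p = c ∧ σ p' = c' ∧ σ q = d ∧ σ q' = d' := by
  obtain ⟨f, hf, hfp, hfp'⟩ := exists_bijOn_two hcard hp hp' hc hc' hpp
  have hcard' : (Icc 1 (2 * n - 2) \ H).card = n - 1 := by
    rw [Finset.card_sdiff_of_subset hH, hcard, Nat.card_Icc]; omega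
  obtain ⟨g, hg, hgq, hgq'⟩ := exists_bijOn_two hcard' hq hq' hd hd' hqq
  refine ⟨fun x => if x ∈ H then f x else g x, ⟨hH, ?_, ?_⟩, ?_, ?_, ?_, ?_⟩
  · exact hf.congr fun x hx => (if_pos hx).symm
  · exact hg.congr fun x hx => (if_neg (Finset.mem_sdiff.1 hx).2).symm
  · simp [hp, hfp]
  · simp [hp', hfp']
  · simp [(Finset.mem_sdiff.1 hq).2, hgq]
  · simp [(Finset.mem_sdiff.1 hq').2, hgq']

theorem sum_sub_sum_of_eq_off_two {ι : Type*} {s : Finset ι} {p q : ι} (hp : p ∈ s)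
    (hq : q ∈ s) (hpq : p ≠ q) (f g : ι → ℝ) (h : ∀ r ∈ s, r ≠ p → r ≠ q → f r = g r) :
    ∑ r ∈ s, f r - ∑ r ∈ s, g r = f p + f q - g p - g q := by
  rw [← Finset.sum_sub_distrib, ← Finset.sum_subset (s₁ := {p, q}), Finset.sum_pair hpq]
  · ring
  · intro x hx
    rcases Finset.mem_insert.1 hx with rfl | hx
    · exact hp
    · rw [Finset.mem_singleton.1 hx]; exact hq
  · intro x hx hx'
    simp only [Finset.mem_insert, Finset.mem_singleton, not_or] at hx'
    rw [h x hx hx'.1 hx'.2, sub_self]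

/-- The value of the weights `a` on the set of matches `T`. -/
noncomputable def total (n : ℕ) (a : ℕ → ℕ → ℕ → ℝ) (T : Set (ℕ × ℕ × ℕ)) : ℝ :=
  ∑ p ∈ Icc 1 (2 * n - 2), ∑ i ∈ Icc 1 n, ∑ j ∈ Icc 1 n, if (p, i, j) ∈ T then a p i j else 0

/-- The weight of the matching `f` in slot `p`, oriented along `R` if `h` holds and against `R`
otherwise. -/
noncomputable def slotWeight (n : ℕ) (a : ℕ → ℕ → ℕ → ℝ) (f : ℕ → ℕ) (R : ℕ → ℕ → Prop)
    (h : Prop) (p : ℕ) : ℝ :=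
  ∑ i ∈ Icc 1 n, if (h ↔ R i (f i)) then a p i (f i) else 0

theorem total_tour {n : ℕ} {a : ℕ → ℕ → ℕ → ℝ} {F : ℕ → ℕ → ℕ} {R : ℕ → ℕ → Prop}
    {H : Finset ℕ} {σ : ℕ → ℕ} (hF : OneFac n F) (hσ : Sched n H σ) :
    total n a (tour n F R H σ) =
      ∑ p ∈ Icc 1 (2 * n - 2), slotWeight n a (F (σ p)) R (p ∈ H) p := by
  refine Finset.sum_congr rfl fun p hp => Finset.sum_congr rfl fun i hi => ?_
  rw [Finset.sum_eq_single (F (σ p) i)]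
  · simp only [mem_tour, hp, hi, true_and]
    congr
  · intro j _ hj
    exact if_neg fun h => hj (mem_tour.1 h).2.2.1
  · exact fun h => absurd (hF.mem (hσ.lt hp) hi) h

theorem IsTournament.sum_pair {n : ℕ} {T : Set (ℕ × ℕ × ℕ)} (hT : IsTournament n T) {i j : ℕ}
    (hi : i ∈ Icc 1 n) (hj : j ∈ Icc 1 n) (hij : i ≠ j) (μ : ℝ) :
    ∑ p ∈ Icc 1 (2 * n - 2), (if (p, i, j) ∈ T then μ else 0) = μ := by
  rw [Finset.mem_Icc] at hi hj
  obtain ⟨p, hp, hu⟩ := hT.pair i j hi.1 hi.2 hj.1 hj.2 hij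
  have hm := hT.subset _ hp
  rw [Finset.sum_eq_single p]
  · rw [if_pos hp]
  · intro q _ hq
    exact if_neg fun h => hq (hu q h)
  · exact fun h => absurd (Finset.mem_Icc.2 ⟨hm.1, hm.2.1⟩) h

theorem IsTournament.sum_slot {n : ℕ} {T : Set (ℕ × ℕ × ℕ)} (hT : IsTournament n T) {p s : ℕ}
    (hp : p ∈ Icc 1 (2 * n - 2)) (hs : s ∈ Icc 1 n) (μ : ℝ) :
    ∑ j ∈ Icc 1 n, (if (p, s, j) ∈ T then μ else 0) +
      ∑ i ∈ Icc 1 n, (if (p, i, s) ∈ T then μ else 0) = μ := by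
  rw [Finset.mem_Icc] at hp hs
  obtain ⟨⟨q, x, y⟩, ⟨hm, hq, hxy⟩, hu⟩ := hT.slot_team p hp.1 hp.2 s hs.1 hs.2
  simp only at hq hxy
  subst hq
  have hmm := hT.subset _ hm
  obtain ⟨-, -, hx1, hx2, hy1, hy2, hne⟩ := hmm
  simp only at hx1 hx2 hy1 hy2 hne
  rcases hxy with rfl | rfl
  · rw [Finset.sum_eq_single y, if_pos hm, Finset.sum_eq_zero, add_zero]
    · intro i _
      refine if_neg fun h => ?_
      have := hu (q, i, s) ⟨h, rfl, Or.inr rfl⟩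
      simp only [Prod.mk.injEq] at this
      exact hne (by rw [this.2.2])
    · intro j _ hj
      refine if_neg fun h => hj ?_
      have := hu (q, s, j) ⟨h, rfl, Or.inl rfl⟩
      simp only [Prod.mk.injEq] at this
      exact this.2.2
    · exact fun h => absurd (Finset.mem_Icc.2 ⟨hy1, hy2⟩) h
  · rw [Finset.sum_eq_zero, zero_add, Finset.sum_eq_single x, if_pos hm]
    · intro i _ hi
      refine if_neg fun h => hi ?_
      have := hu (q, i, s) ⟨h, rfl, Or.inr rfl⟩
      simp only [Prod.mk.injEq] at this
      exact this.2.1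
    · exact fun h => absurd (Finset.mem_Icc.2 ⟨hx1, hx2⟩) h
    · intro j _
      refine if_neg fun h => ?_
      have := hu (q, s, j) ⟨h, rfl, Or.inl rfl⟩
      simp only [Prod.mk.injEq] at this
      exact hne (by rw [this.2.1])

/-- Weights of the form `μ i j + Λ p i + Λ p j` have the same value on all tournaments. -/
theorem total_eq_of_form {n : ℕ} {a : ℕ → ℕ → ℕ → ℝ} {μ Λ : ℕ → ℕ → ℝ}
    (ha : ∀ p ∈ Icc 1 (2 * n - 2), ∀ i ∈ Icc 1 n, ∀ j ∈ Icc 1 n, i ≠ j →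
      a p i j = μ i j + Λ p i + Λ p j)
    {T : Set (ℕ × ℕ × ℕ)} (hT : IsTournament n T) :
    total n a T = ∑ i ∈ Icc 1 n, ∑ j ∈ Icc 1 n, (if i ≠ j then μ i j else 0) +
      ∑ p ∈ Icc 1 (2 * n - 2), ∑ s ∈ Icc 1 n, Λ p s := by
  have h1 : total n a T = ∑ p ∈ Icc 1 (2 * n - 2), ∑ i ∈ Icc 1 n, ∑ j ∈ Icc 1 n,
      (if (p, i, j) ∈ T then μ i j else 0) +
      ∑ p ∈ Icc 1 (2 * n - 2), (∑ i ∈ Icc 1 n, ∑ j ∈ Icc 1 n,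
        (if (p, i, j) ∈ T then Λ p i else 0) +
        ∑ i ∈ Icc 1 n, ∑ j ∈ Icc 1 n, (if (p, i, j) ∈ T then Λ p j else 0)) := by
    simp only [total, ← Finset.sum_add_distrib]
    refine Finset.sum_congr rfl fun p hp => Finset.sum_congr rfl fun i hi =>
      Finset.sum_congr rfl fun j hj => ?_
    split_ifs with h
    · rw [ha p hp i hi j hj (hT.subset _ h).2.2.2.2.2.2, add_assoc]
    · simp
  rw [h1]
  congr 1
  · rw [Finset.sum_comm]
    refine Finset.sum_congr rfl fun i hi => ?_
    rw [Finset.sum_comm]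
    refine Finset.sum_congr rfl fun j hj => ?_
    split_ifs with h
    · exact hT.sum_pair hi hj h _
    · refine Finset.sum_eq_zero fun p _ => if_neg fun h' => ?_
      exact h (hT.subset _ h').2.2.2.2.2.2
  · refine Finset.sum_congr rfl fun p hp => ?_
    rw [add_comm, Finset.sum_comm, add_comm, ← Finset.sum_add_distrib]
    exact Finset.sum_congr rfl fun s hs => hT.sum_slot hp hs _

theorem Sched.swap_away {n : ℕ} {H : Finset ℕ} {σ : ℕ → ℕ} (h : Sched n H σ) {p q : ℕ}
    (hp : p ∈ Icc 1 (2 * n - 2)) (hq : q ∈ Icc 1 (2 * n - 2)) (hpq : p ∈ H ↔ q ∈ H) :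
    Sched n H (σ ∘ Equiv.swap p q) := by
  have key : ∀ S : Finset ℕ, (p ∈ S ↔ q ∈ S) → Set.BijOn (Equiv.swap p q) S S := by
    intro S hS
    have hmap : Set.MapsTo (Equiv.swap p q) (S : Set ℕ) S := by
      intro z hz
      rw [Finset.mem_coe] at hz ⊢
      rw [Equiv.swap_apply_def]
      split_ifs with h1 h2
      · subst h1; exact hS.1 hz
      · subst h2; exact hS.2 hz
      · exact hz
    exact ⟨hmap, (Equiv.swap p q).injective.injOn,
      fun z hz => ⟨_, hmap hz, Equiv.swap_apply_self _ _ _⟩⟩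
  refine ⟨h.sub, h.home.comp (key _ hpq), h.away.comp (key _ ?_)⟩
  simp only [Finset.mem_sdiff, hp, hq, hpq]

theorem Sched.move {n : ℕ} {H : Finset ℕ} {σ : ℕ → ℕ} (h : Sched n H σ) {p q : ℕ}
    (hp : p ∈ H) (hq : q ∈ Icc 1 (2 * n - 2)) (hqH : q ∉ H) :
    Sched n (insert q (H.erase p)) (σ ∘ Equiv.swap p q) := by
  have hpq : p ≠ q := fun e => hqH (e ▸ hp)
  have key : ∀ S S' : Finset ℕ, (∀ z, z ∈ S ↔ Equiv.swap p q z ∈ S') →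
      Set.BijOn (Equiv.swap p q) S S' := by
    intro S S' hS
    refine ⟨fun z hz => (hS z).1 hz, (Equiv.swap p q).injective.injOn, fun z hz => ?_⟩
    refine ⟨Equiv.swap p q z, (hS _).2 ?_, Equiv.swap_apply_self _ _ _⟩
    rwa [Equiv.swap_apply_self]
  have hH : ∀ z, z ∈ insert q (H.erase p) ↔ Equiv.swap p q z ∈ H := by
    intro z
    rw [Equiv.swap_apply_def]
    split_ifs with h1 h2
    · subst h1; simp [hpq, hqH]
    · subst h2; simp [hp]
    · simp [h1, h2]
  have hI : ∀ z, z ∈ Icc 1 (2 * n - 2) ↔ Equiv.swap p q z ∈ Icc 1 (2 * n - 2) := by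
    intro z
    have hp' := h.sub hp
    rw [Equiv.swap_apply_def]
    split_ifs with h1 h2
    · subst h1; simp only [hp', hq]
    · subst h2; simp only [hp', hq]
    · rfl
  refine ⟨?_, h.home.comp (key _ _ hH), h.away.comp (key _ _ fun z => ?_)⟩
  · intro z hz
    rcases Finset.mem_insert.1 hz with rfl | hz
    · exact hq
    · exact h.sub (Finset.mem_of_mem_erase hz)
  · rw [Finset.mem_sdiff, Finset.mem_sdiff, hH, hI]

/-- Exchanging `x` and `y` in the matching `f` only affects the edges at `x` and `y`. -/
theorem sum_matching_swap {n : ℕ} {G : ℕ → ℕ → ℝ} {f : ℕ → ℕ} {x y : ℕ}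
    (hG : ∀ i ∈ Icc 1 n, ∀ j ∈ Icc 1 n, i ≠ j → G i j = G j i)
    (hmem : ∀ i ∈ Icc 1 n, f i ∈ Icc 1 n) (hne : ∀ i ∈ Icc 1 n, f i ≠ i)
    (hinv : ∀ i ∈ Icc 1 n, f (f i) = i) (hx : x ∈ Icc 1 n) (hy : y ∈ Icc 1 n) (hxy : x ≠ y)
    (hf : f x ≠ y) :
    ∑ i ∈ Icc 1 n, G i (f i) -
      ∑ i ∈ Icc 1 n, G i (Equiv.swap x y (f (Equiv.swap x y i))) =
      2 * ((G x (f x) - G y (f x)) - (G x (f y) - G y (f y))) := by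
  have hfy : f y ≠ x := fun h => hf (by rw [← h, hinv y hy])
  have hff : f x ≠ f y := fun h => hxy (by rw [← hinv x hx, h, hinv y hy])
  have hre : ∑ i ∈ Icc 1 n, G i (Equiv.swap x y (f (Equiv.swap x y i))) =
      ∑ i ∈ Icc 1 n, G (Equiv.swap x y i) (Equiv.swap x y (f i)) := by
    have hs : ∀ i ∈ Icc 1 n, Equiv.swap x y i ∈ Icc 1 n := by
      intro i hi
      rw [Equiv.swap_apply_def]
      split_ifs <;> assumption
    exact Finset.sum_bij' (fun i _ => Equiv.swap x y i) (fun i _ => Equiv.swap x y i) hs hs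
      (fun _ _ => Equiv.swap_apply_self _ _ _) (fun _ _ => Equiv.swap_apply_self _ _ _)
      (fun i _ => by simp only [Equiv.swap_apply_self])
  rw [hre, ← Finset.sum_sub_distrib,
    ← Finset.sum_subset (s₁ := {x, y, f x, f y})]
  · rw [Finset.sum_insert, Finset.sum_insert, Finset.sum_pair hff, hinv x hx, hinv y hy,
      Equiv.swap_apply_left, Equiv.swap_apply_right,
      Equiv.swap_apply_of_ne_of_ne (hne x hx) hf, Equiv.swap_apply_of_ne_of_ne hfy (hne y hy),
      hG (f x) (hmem x hx) x hx (hne x hx), hG (f x) (hmem x hx) y hy hf,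
      hG (f y) (hmem y hy) x hx hfy, hG (f y) (hmem y hy) y hy (hne y hy)]
    · ring
    · simp only [Finset.mem_insert, Finset.mem_singleton, not_or]
      exact ⟨hf.symm, (hne y hy).symm⟩
    · simp only [Finset.mem_insert, Finset.mem_singleton, not_or]
      exact ⟨hxy, (hne x hx).symm, hfy.symm⟩
  · intro i hi
    simp only [Finset.mem_insert, Finset.mem_singleton] at hi
    rcases hi with rfl | rfl | rfl | rfl
    exacts [hx, hy, hmem x hx, hmem y hy]
  · intro i hi hi'
    simp only [Finset.mem_insert, Finset.mem_singleton, not_or] at hi'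
    obtain ⟨h1, h2, h3, h4⟩ := hi'
    have h5 : f i ≠ x := fun h => h3 (by rw [← h, hinv i hi])
    have h6 : f i ≠ y := fun h => h4 (by rw [← h, hinv i hi])
    rw [Equiv.swap_apply_of_ne_of_ne h1 h2, Equiv.swap_apply_of_ne_of_ne h5 h6, sub_self]

section FourPoint

variable {n : ℕ} {G : ℕ → ℕ → ℝ}

theorem four_point_aux
    (hG : ∀ i ∈ Icc 1 n, ∀ j ∈ Icc 1 n, i ≠ j → G i j = G j i)
    (hF : ∀ F, OneFac n F → ∀ c < n - 1, ∀ d < n - 1,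
      ∑ i ∈ Icc 1 n, G i (F c i) = ∑ i ∈ Icc 1 n, G i (F d i))
    {F : ℕ → ℕ → ℕ} (h : OneFac n F) {c d x y z : ℕ} (hc : c < n - 1) (hd : d < n - 1)
    (hx : x ∈ Icc 1 n) (hy : y ∈ Icc 1 n) (hz : z ∈ Icc 1 n) (hxy : x ≠ y)
    (hcz : F c z = y) (hdz : F d z = x) :
    (G x (F c x) - G y (F c x)) + (G x (F d y) - G y (F d y)) = 2 * (G x z - G y z) := by
  have hcy : F c y = z := by rw [← hcz, h.inv hc hz]
  have hdx : F d x = z := by rw [← hdz, h.inv hd hz]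
  have hzx : z ≠ x := fun e => h.ne hd hz (by rw [hdz, e])
  have hzy : z ≠ y := fun e => h.ne hc hz (by rw [hcz, e])
  have e1 := hF F h c hc d hd
  have e2 := hF _ (h.swap hx hy) c hc d hd
  have s1 := sum_matching_swap (f := F c) hG (fun i hi => h.mem hc hi) (fun i hi => h.ne hc hi)
    (fun i hi => h.inv hc hi) hx hy hxy
    (fun e => hzx (by rw [← hcy, ← e, h.inv hc hx]))
  have s2 := sum_matching_swap (f := F d) hG (fun i hi => h.mem hd hi) (fun i hi => h.ne hd hi)
    (fun i hi => h.inv hd hi) hx hy hxy (by rw [hdx]; exact hzy)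
  rw [hcy] at s1
  rw [hdx] at s2
  linarith

theorem four_point_of_matching (hn : 4 ≤ n) (he : Even n)
    (hG : ∀ i ∈ Icc 1 n, ∀ j ∈ Icc 1 n, i ≠ j → G i j = G j i)
    (hF : ∀ F, OneFac n F → ∀ c < n - 1, ∀ d < n - 1,
      ∑ i ∈ Icc 1 n, G i (F c i) = ∑ i ∈ Icc 1 n, G i (F d i))
    {x y z w : ℕ} (hx : x ∈ Icc 1 n) (hy : y ∈ Icc 1 n) (hz : z ∈ Icc 1 n) (hw : w ∈ Icc 1 n)
    (hxy : x ≠ y) (hxz : x ≠ z) (hyz : y ≠ z) (hwx : w ≠ x) (hwy : w ≠ y) :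
    G x z - G y z = G x w - G y w := by
  have step : ∀ F, OneFac n F → F 0 z = y → F 1 z = x →
      G x (F 0 x) - G y (F 0 x) = G x z - G y z := by
    intro F h h0 h1
    have hc : 0 < n - 1 := by omega
    have hd : 1 < n - 1 := by omega
    have e1 := four_point_aux hG hF h hc hd hx hy hz hxy h0 h1
    by_cases hab : F 0 x = F 1 y
    · rw [← hab] at e1; linarith
    have hay : F 0 x ≠ y := fun e => hxz (by rw [← h.inv hc hx, e, ← h0, h.inv hc hz])
    have hax : F 0 x ≠ x := h.ne hc hx
    have hbz : F 1 y ≠ z := fun e => hxy (by rw [← h1, ← e, h.inv hd hy])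
    have e2 := four_point_aux hG hF (h.swap (h.mem hc hx) hz) hc hd hx hy (h.mem hc hx) hxy
      (by simp only [Equiv.swap_apply_left, h0]; exact Equiv.swap_apply_of_ne_of_ne hay.symm hyz)
      (by simp only [Equiv.swap_apply_left, h1]; exact Equiv.swap_apply_of_ne_of_ne hax.symm hxz)
    simp only [Equiv.swap_apply_of_ne_of_ne hax.symm hxz,
      Equiv.swap_apply_of_ne_of_ne hay.symm hyz, Equiv.swap_apply_left,
      Equiv.swap_apply_of_ne_of_ne (Ne.symm hab) hbz] at e2
    linarith
  obtain ⟨F, h, h0, h1⟩ : ∃ F, OneFac n F ∧ F 0 z = y ∧ F 1 z = x := by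
    have hc : 0 < n - 1 := by omega
    have hd : 1 < n - 1 := by omega
    have h := oneFac_canonFac hn he
    set F := canonFac n
    have h' := h.swap (h.mem hd hz) hx
    set F' : ℕ → ℕ → ℕ := fun c i => Equiv.swap (F 1 z) x (F c (Equiv.swap (F 1 z) x i)) with hF'
    have h1 : F' 1 z = x := by
      simp only [hF', Equiv.swap_apply_of_ne_of_ne (h.ne hd hz).symm hxz.symm,
        Equiv.swap_apply_left]
    have h0x : F' 0 z ≠ x := fun e => by
      have := h'.uniq hc hd hz (e.trans h1.symm)
      omega
    have h0z : F' 0 z ≠ z := h'.ne hc hz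
    refine ⟨_, h'.swap (h'.mem hc hz) hy, ?_, ?_⟩
    · simp only [Equiv.swap_apply_of_ne_of_ne h0z.symm hyz.symm, Equiv.swap_apply_left]
    · simp only [Equiv.swap_apply_of_ne_of_ne h0z.symm hyz.symm, h1]
      exact Equiv.swap_apply_of_ne_of_ne h0x.symm hxy
  by_cases hwz : w = z
  · rw [hwz]
  have hc : 0 < n - 1 := by omega
  have hay : F 0 x ≠ y := fun e => hxz (by rw [← h.inv hc hx, e, ← h0, h.inv hc hz])
  have haz : F 0 x ≠ z := fun e => hxy (by rw [← h.inv hc hx, e, h0])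
  have hax : F 0 x ≠ x := h.ne hc hx
  have e := step _ (h.swap (h.mem hc hx) hw)
    (by simp only [Equiv.swap_apply_of_ne_of_ne haz.symm (Ne.symm hwz), h0]
        exact Equiv.swap_apply_of_ne_of_ne hay.symm hwy.symm)
    (by simp only [Equiv.swap_apply_of_ne_of_ne haz.symm (Ne.symm hwz), h1]
        exact Equiv.swap_apply_of_ne_of_ne hax.symm hwx.symm)
  simp only [Equiv.swap_apply_of_ne_of_ne hax.symm hwx.symm, Equiv.swap_apply_left] at e
  exact e.symm

theorem exists_potential (hn : 4 ≤ n)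
    (hG : ∀ i ∈ Icc 1 n, ∀ j ∈ Icc 1 n, i ≠ j → G i j = G j i)
    (h4 : ∀ x ∈ Icc 1 n, ∀ y ∈ Icc 1 n, ∀ z ∈ Icc 1 n, ∀ w ∈ Icc 1 n, x ≠ y → x ≠ z → y ≠ z →
      w ≠ x → w ≠ y → G x z - G y z = G x w - G y w) :
    ∃ Λ : ℕ → ℝ, ∀ i ∈ Icc 1 n, ∀ j ∈ Icc 1 n, i ≠ j → G i j = Λ i + Λ j := by
  have h1 : (1 : ℕ) ∈ Icc 1 n := Finset.mem_Icc.2 (by omega)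
  have h2 : (2 : ℕ) ∈ Icc 1 n := Finset.mem_Icc.2 (by omega)
  have h3 : (3 : ℕ) ∈ Icc 1 n := Finset.mem_Icc.2 (by omega)
  have key : ∀ i ∈ Icc 1 n, ∀ j ∈ Icc 1 n, ∀ k ∈ Icc 1 n, i ≠ 1 → j ≠ 1 → k ≠ 1 → i ≠ j →
      i ≠ k → G 1 i + G 1 j - G i j = G 1 i + G 1 k - G i k := by
    intro i hi j hj k hk hi1 hj1 hk1 hij hik
    have := h4 1 h1 i hi j hj k hk hi1.symm hj1.symm hij hk1 hik.symm
    linarith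
  have key2 : ∀ i ∈ Icc 1 n, ∀ j ∈ Icc 1 n, i ≠ 1 → j ≠ 1 → i ≠ j →
      G 1 i + G 1 j - G i j = G 1 2 + G 1 3 - G 2 3 := by
    intro i hi j hj hi1 hj1 hij
    by_cases hi2 : i = 2
    · subst hi2; exact key 2 hi j hj 3 h3 hi1 hj1 (by omega) hij (by omega)
    · rw [key i hi j hj 2 h2 hi1 hj1 (by omega) hij hi2, hG i hi 2 h2 hi2, add_comm (G 1 i)]
      exact key 2 h2 i hi 3 h3 (by omega) hi1 (by omega) (Ne.symm hi2) (by omega)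
  set K := G 1 2 + G 1 3 - G 2 3
  refine ⟨fun i => if i = 1 then K / 2 else G 1 i - K / 2, fun i hi j hj hij => ?_⟩
  by_cases hi1 : i = 1
  · subst hi1; simp [Ne.symm hij]
  · by_cases hj1 : j = 1
    · subst hj1; simp [hi1, hG i hi 1 h1 hi1]
    · simp only [hi1, hj1, if_false]
      linarith [key2 i hi j hj hi1 hj1 hij]

end FourPoint

/-- The home slots of a team whose away games occupy the slots `s, …, s+n-2`. -/
def blk (n s : ℕ) : Finset ℕ := Icc 1 (2 * n - 2) \ Icc s (s + n - 2)

/-- The slots after which a team with set of home slots `H` leaves home. -/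
noncomputable def dep (n : ℕ) (H : Finset ℕ) : Finset ℕ :=
  (range (2 * n - 2)).filter fun r => (r = 0 ∨ r ∈ H) ∧ r + 1 ∉ H

theorem mem_blk {n s p : ℕ} : p ∈ blk n s ↔ (1 ≤ p ∧ p ≤ 2 * n - 2) ∧ ¬(s ≤ p ∧ p ≤ s + n - 2) := by
  rw [blk, Finset.mem_sdiff, Finset.mem_Icc, Finset.mem_Icc]

theorem mem_dep {n r : ℕ} {H : Finset ℕ} :
    r ∈ dep n H ↔ r < 2 * n - 2 ∧ (r = 0 ∨ r ∈ H) ∧ r + 1 ∉ H := by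
  rw [dep, Finset.mem_filter, Finset.mem_range]

theorem blk_subset {n s : ℕ} : blk n s ⊆ Icc 1 (2 * n - 2) := Finset.sdiff_subset

theorem card_blk {n s : ℕ} (hn : 4 ≤ n) (hs : s ∈ Icc 1 n) : (blk n s).card = n - 1 := by
  rw [Finset.mem_Icc] at hs
  rw [blk, Finset.card_sdiff_of_subset, Nat.card_Icc, Nat.card_Icc]
  · omega
  · intro x hx
    rw [Finset.mem_Icc] at hx ⊢
    omega

theorem dep_blk {n s : ℕ} (hn : 4 ≤ n) (hs : s ∈ Icc 1 n) : dep n (blk n s) = {s - 1} := by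
  rw [Finset.mem_Icc] at hs
  ext r
  rw [mem_dep, mem_blk, mem_blk, Finset.mem_singleton]
  omega

theorem blk_succ {n s : ℕ} (hn : 4 ≤ n) (hs : s ∈ Icc 1 (n - 1)) :
    blk n (s + 1) = insert s ((blk n s).erase (s + n - 1)) := by
  rw [Finset.mem_Icc] at hs
  ext r
  rw [mem_blk, Finset.mem_insert, Finset.mem_erase, mem_blk]
  omega

theorem exists_sched_blk {n s : ℕ} (hn : 4 ≤ n) (hs : s ∈ Icc 1 n) {p p' c c' q q' d d' : ℕ}
    (hp : p ∈ blk n s) (hp' : p' ∈ blk n s)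
    (hc : c < n - 1) (hc' : c' < n - 1) (hpp : p = p' ↔ c = c')
    (hq : s ≤ q ∧ q ≤ s + n - 2) (hq' : s ≤ q' ∧ q' ≤ s + n - 2)
    (hd : d < n - 1) (hd' : d' < n - 1) (hqq : q = q' ↔ d = d') :
    ∃ σ, Sched n (blk n s) σ ∧ σ p = c ∧ σ p' = c' ∧ σ q = d ∧ σ q' = d' := by
  have hs' := Finset.mem_Icc.1 hs
  refine exists_sched hn blk_subset (card_blk hn hs) hp hp' hc hc' hpp ?_ ?_ hd hd' hqq
  · rw [Finset.mem_sdiff, mem_blk, Finset.mem_Icc]; omega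
  · rw [Finset.mem_sdiff, mem_blk, Finset.mem_Icc]; omega

/-- A ranking with `t` first, followed by `i` and `j`. -/
def rk (t i j x : ℕ) : ℕ := if x = t then 0 else if x = i then 1 else if x = j then 2 else x + 3

theorem orient_rk (t i j : ℕ) : Orient t fun x y => rk t i j x < rk t i j y where
  tot {x y} h := by
    simp only [rk]
    split_ifs <;> omega
  top {x} h := by
    simp only [rk]
    split_ifs <;> omega

theorem rk_lt_iff {t i j x y : ℕ} (h1 : ¬(x = i ∧ y = j))
    (h2 : ¬(x = j ∧ y = i)) : (rk t i j x < rk t i j y ↔ rk t j i x < rk t j i y) := by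
  simp only [rk]
  split_ifs <;> omega

theorem slotWeight_congr {n : ℕ} {a : ℕ → ℕ → ℕ → ℝ} {f : ℕ → ℕ} {R R' : ℕ → ℕ → Prop}
    {h h' : Prop} {p : ℕ} (hh : h ↔ h') (hR : ∀ i ∈ Icc 1 n, (R i (f i) ↔ R' i (f i))) :
    slotWeight n a f R h p = slotWeight n a f R' h' p := by
  refine Finset.sum_congr rfl fun i hi => ?_
  rw [hR i hi, hh]

theorem slotWeight_sub {n : ℕ} {a : ℕ → ℕ → ℕ → ℝ} {f : ℕ → ℕ} {R : ℕ → ℕ → Prop}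
    {h : Prop} {p q : ℕ} :
    slotWeight n a f R h p - slotWeight n a f R h q =
      ∑ i ∈ Icc 1 n, if (h ↔ R i (f i)) then a p i (f i) - a q i (f i) else 0 := by
  rw [slotWeight, slotWeight, ← Finset.sum_sub_distrib]
  refine Finset.sum_congr rfl fun i _ => ?_
  split_ifs <;> simp

section Weights

variable {n t k : ℕ} {Good : Finset ℕ → Prop} {a : ℕ → ℕ → ℕ → ℝ} {b : ℕ → ℝ} {C : ℝ}

theorem b_const (hn : 4 ≤ n) (he : Even n) (ht : t ∈ Icc 1 n)
    (hA : ∀ s ∈ Icc 1 n, Good (blk n s))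
    (hK : ∀ F R H σ, OneFac n F → Orient t R → Sched n H σ → Good H →
      total n a (tour n F R H σ) + ∑ r ∈ dep n H, b (F (σ (r + 1)) t) = C) :
    ∀ i ∈ Icc 1 n, ∀ j ∈ Icc 1 n, i ≠ t → j ≠ t → b i = b j := by
  have hF := oneFac_canonFac hn he
  set F := canonFac n
  have hR := orient_rk t 0 0
  set R := fun x y => rk t 0 0 x < rk t 0 0 y
  have h1n : (1 : ℕ) ∈ Icc 1 n := Finset.mem_Icc.2 (by omega)
  have h2n : (2 : ℕ) ∈ Icc 1 n := Finset.mem_Icc.2 (by omega)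
  have key : ∀ c < n - 1, ∀ d < n - 1, c ≠ d → b (F d t) - b (F c t) =
      slotWeight n a (F c) R False 1 + slotWeight n a (F c) R True n
        - slotWeight n a (F c) R True 1 - slotWeight n a (F c) R False n := by
    intro c hc d hd hcd
    obtain ⟨σ, hσ, hσn, -, hσ1, hσ2⟩ := exists_sched_blk (s := 1) hn h1n (p := n) (p' := n)
      (c := c) (c' := c) (q := 1) (q' := 2) (d := c) (d' := d) (by rw [mem_blk]; omega)
      (by rw [mem_blk]; omega) hc hc (by simp) (by omega) (by omega) hc hd (by omega)
    have hn1 : n ∈ blk n 1 := by rw [mem_blk]; omega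
    have h11 : 1 ∉ blk n 1 := by rw [mem_blk]; omega
    have hσ' := hσ.move (p := n) (q := 1) hn1 (Finset.mem_Icc.2 (by omega)) h11
    have hb : blk n 2 = insert 1 ((blk n 1).erase n) := by
      have := blk_succ (s := 1) hn (Finset.mem_Icc.2 (by omega))
      rwa [show 1 + n - 1 = n by omega] at this
    have hcomp : σ ∘ Equiv.swap n 1 = σ := by
      funext x
      simp only [Function.comp, Equiv.swap_apply_def]
      split_ifs with h h
      · rw [h, hσ1, hσn]
      · rw [h, hσ1, hσn]
      · rfl
    rw [hcomp, ← hb] at hσ'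
    have e1 := hK F R _ σ hF hR hσ (hA 1 h1n)
    have e2 := hK F R _ σ hF hR hσ' (hA 2 h2n)
    rw [dep_blk hn h1n, Finset.sum_singleton, total_tour hF hσ] at e1
    rw [dep_blk hn h2n, Finset.sum_singleton, total_tour hF hσ'] at e2
    simp only [Nat.sub_self, zero_add, hσ1] at e1
    simp only [show 2 - 1 + 1 = 2 from rfl, hσ2] at e2
    have e3 := sum_sub_sum_of_eq_off_two (s := Icc 1 (2 * n - 2)) (p := 1) (q := n)
      (Finset.mem_Icc.2 (by omega)) (Finset.mem_Icc.2 (by omega)) (by omega)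
      (fun p => slotWeight n a (F (σ p)) R (p ∈ blk n 1) p)
      (fun p => slotWeight n a (F (σ p)) R (p ∈ blk n 2) p)
      (fun r hr h1 h2 => slotWeight_congr (by rw [hb]; simp [h1, h2]) fun _ _ => Iff.rfl)
    simp only [hσ1, hσn] at e3
    have m1 : (1 ∈ blk n 1) = False := by simp [h11]
    have m2 : (n ∈ blk n 1) = True := by simp [hn1]
    have m3 : (1 ∈ blk n 2) = True := by rw [hb]; simp
    have m4 : (n ∈ blk n 2) = False := by
      rw [hb]; simp only [Finset.mem_insert, Finset.mem_erase, eq_iff_iff, iff_false]; omega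
    rw [m1, m2, m3, m4] at e3
    linarith
  intro i hi j hj hit hjt
  obtain ⟨c, hc, rfl⟩ := hF.ex ht hi hit.symm
  obtain ⟨d, hd, rfl⟩ := hF.ex ht hj hjt.symm
  obtain ⟨e, he, hec, hed⟩ : ∃ e < n - 1, e ≠ c ∧ e ≠ d := by
    by_contra! hcon
    have h0 := hcon 0 (by omega)
    have h1 := hcon 1 (by omega)
    have h2 := hcon 2 (by omega)
    omega
  linarith [key e he c hc hec, key e he d hd hed]

theorem antisymm_const (hn : 4 ≤ n) (he : Even n)
    (hA : ∀ s ∈ Icc 1 n, Good (blk n s))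
    (hK : ∀ F R H σ, OneFac n F → Orient t R → Sched n H σ → Good H →
      total n a (tour n F R H σ) + ∑ r ∈ dep n H, b (F (σ (r + 1)) t) = C)
    {i j : ℕ} (hi : i ∈ Icc 1 n) (hj : j ∈ Icc 1 n) (hij : i ≠ j) (hit : i ≠ t) (hjt : j ≠ t)
    {p q : ℕ} (hp : p ∈ Icc 1 (2 * n - 2)) (hq : q ∈ Icc 1 (2 * n - 2)) :
    a p i j - a p j i = a q i j - a q j i := by
  have hF := oneFac_canonFac hn he
  set F := canonFac n
  obtain ⟨c, hc, hcF⟩ := hF.ex hi hj hij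
  have hcF' : F c j = i := by rw [← hcF, hF.inv hc hi]
  have h1n : (1 : ℕ) ∈ Icc 1 n := Finset.mem_Icc.2 (by omega)
  have hw : ∀ h : Prop, ∀ p, slotWeight n a (F c) (fun x y => rk t i j x < rk t i j y) h p -
      slotWeight n a (F c) (fun x y => rk t j i x < rk t j i y) h p =
      if h then a p i j - a p j i else a p j i - a p i j := by
    intro h p
    rw [slotWeight, slotWeight, sum_sub_sum_of_eq_off_two hi hj hij]
    · have r1 : rk t i j i < rk t i j j := by simp [rk, hit, hjt, hij.symm]
      have r2 : ¬ rk t i j j < rk t i j i := by omega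
      have r3 : rk t j i j < rk t j i i := by simp [rk, hit, hjt, hij]
      have r4 : ¬ rk t j i i < rk t j i j := by omega
      simp only [hcF, hcF', r1, r2, r3, r4, iff_true, iff_false]
      split_ifs <;> simp
    · intro r hr hri hrj
      simp only [rk_lt_iff (fun h => hri h.1 : ¬(r = i ∧ F c r = j))
        (fun h => hrj h.1)]
      congr
  have key : ∀ p, 1 ≤ p → p ≤ n - 1 → ∀ q, n ≤ q → q ≤ 2 * n - 2 →
      a p i j - a p j i = a q i j - a q j i := by
    intro p hp1 hp2 q hq1 hq2
    have hqb : q ∈ blk n 1 := by rw [mem_blk]; omega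
    have hpb : p ∉ blk n 1 := by rw [mem_blk]; omega
    have hpI : p ∈ Icc 1 (2 * n - 2) := Finset.mem_Icc.2 (by omega)
    obtain ⟨σ, hσ, hσq, -, hσp, -⟩ := exists_sched_blk (s := 1) hn h1n (p := q) (p' := q)
      (c := c) (c' := c) (q := p) (q' := p) (d := c) (d' := c) hqb hqb hc hc (by simp)
      (by omega) (by omega) hc hc (by simp)
    have e1 := hK F _ _ σ hF (orient_rk t i j) hσ (hA 1 h1n)
    have e2 := hK F _ _ σ hF (orient_rk t j i) hσ (hA 1 h1n)
    rw [total_tour hF hσ] at e1 e2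
    have e3 := sum_sub_sum_of_eq_off_two (s := Icc 1 (2 * n - 2)) (p := p) (q := q)
      hpI (Finset.mem_Icc.2 (by omega)) (by omega)
      (fun p => slotWeight n a (F (σ p)) (fun x y => rk t i j x < rk t i j y) (p ∈ blk n 1) p)
      (fun p => slotWeight n a (F (σ p)) (fun x y => rk t j i x < rk t j i y) (p ∈ blk n 1) p)
      (fun r hr h1 h2 => slotWeight_congr Iff.rfl fun x hx => by
        have hσr : σ r ≠ c := by
          intro e
          by_cases hrb : r ∈ blk n 1
          · exact h2 (hσ.home.2.1 hrb hqb (by rw [e, hσq]))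
          · refine h1 (hσ.away.2.1 ?_ ?_ (by rw [e, hσp]))
            · exact Finset.mem_coe.2 (Finset.mem_sdiff.2 ⟨hr, hrb⟩)
            · exact Finset.mem_coe.2 (Finset.mem_sdiff.2 ⟨hpI, hpb⟩)
        refine rk_lt_iff ?_ ?_
        · rintro ⟨rfl, h⟩
          exact hσr (hF.uniq (hσ.lt hr) hc hx (by rw [h, hcF]))
        · rintro ⟨rfl, h⟩
          exact hσr (hF.uniq (hσ.lt hr) hc hx (by rw [h, hcF'])))
    simp only [hσp, hσq] at e3
    have w1 := hw (p ∈ blk n 1) p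
    have w2 := hw (q ∈ blk n 1) q
    rw [if_neg hpb] at w1
    rw [if_pos hqb] at w2
    linarith
  rw [Finset.mem_Icc] at hp hq
  by_cases h1 : p ≤ n - 1 <;> by_cases h2 : q ≤ n - 1
  · linarith [key p hp.1 h1 n le_rfl (by omega), key q hq.1 h2 n le_rfl (by omega)]
  · exact key p hp.1 h1 q (by omega) hq.2
  · exact (key q hq.1 h2 p (by omega) hp.2).symm
  · linarith [key 1 le_rfl (by omega) p (by omega) hp.2, key 1 le_rfl (by omega) q (by omega) hq.2]

/-- The symmetric weight of an edge when `t` only plays away. -/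
def awayWeight (t : ℕ) (a : ℕ → ℕ → ℕ → ℝ) (p i j : ℕ) : ℝ := if i = t then a p j t else a p i j

theorem two_mul_slotWeight_sub {f : ℕ → ℕ} {R : ℕ → ℕ → Prop} (hR : Orient t R)
    (hmem : ∀ i ∈ Icc 1 n, f i ∈ Icc 1 n) (hne : ∀ i ∈ Icc 1 n, f i ≠ i)
    (hinv : ∀ i ∈ Icc 1 n, f (f i) = i) {p q : ℕ}
    (hD : ∀ i ∈ Icc 1 n, ∀ j ∈ Icc 1 n, i ≠ j → i ≠ t → j ≠ t →
      a p i j - a p j i = a q i j - a q j i) :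
    2 * (slotWeight n a f R False p - slotWeight n a f R False q) =
      ∑ i ∈ Icc 1 n, (awayWeight t a p i (f i) - awayWeight t a q i (f i)) := by
  rw [slotWeight_sub, two_mul]
  nth_rewrite 2 [Finset.sum_bij' (fun i _ => f i) (fun i _ => f i) hmem hmem
    (fun i hi => hinv i hi) (fun i hi => hinv i hi)
    (g := fun i => if (False ↔ R (f i) i) then a p (f i) i - a q (f i) i else 0)
    (fun i hi => by simp only [hinv i hi]; congr)]
  rw [← Finset.sum_add_distrib]
  refine Finset.sum_congr rfl fun i hi => ?_
  have htot := hR.tot (hne i hi)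
  by_cases hit : i = t
  · have hRt : R i (f i) := by
      rw [hit]; exact hR.top (by rw [← hit]; exact hne i hi)
    have hRt' : ¬ R (f i) i := fun h => (htot.1 h) hRt
    rw [if_neg (by simp [hRt]), if_pos (by simp [hRt'])]
    simp [awayWeight, hit]
  · by_cases hft : f i = t
    · have hRt : R (f i) i := by
        rw [hft]; exact hR.top hit
      have hRt' : ¬ R i (f i) := htot.1 hRt
      rw [if_pos (by simp [hRt']), if_neg (by simp [hRt])]
      simp [awayWeight, hit]
    · have := hD i hi (f i) (hmem i hi) (hne i hi).symm hit hft
      simp only [awayWeight, hit, if_false]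
      by_cases hRi : R (f i) i
      · rw [if_pos (by simp [htot.1 hRi]), if_neg (by simp [hRi])]
        ring
      · have : R i (f i) := by
          by_contra h; exact hRi (htot.2 h)
        rw [if_neg (by simp [this]), if_pos (by simp [hRi])]
        linarith

theorem slotWeight_exchange (hn : 4 ≤ n)
    (hA : ∀ s ∈ Icc 1 n, Good (blk n s))
    (hK : ∀ F R H σ, OneFac n F → Orient t R → Sched n H σ → Good H →
      total n a (tour n F R H σ) = C)
    {F : ℕ → ℕ → ℕ} {R : ℕ → ℕ → Prop} (hF : OneFac n F) (hR : Orient t R) {p : ℕ} (hp1 : 1 ≤ p)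
    (hp2 : p + 1 ≤ 2 * n - 2) {c d : ℕ} (hc : c < n - 1) (hd : d < n - 1) (hcd : c ≠ d) :
    slotWeight n a (F c) R False p - slotWeight n a (F c) R False (p + 1) =
      slotWeight n a (F d) R False p - slotWeight n a (F d) R False (p + 1) := by
  obtain ⟨s, hs, hsp, hsp'⟩ : ∃ s ∈ Icc 1 n, s ≤ p ∧ p + 1 ≤ s + n - 2 := by
    by_cases h : p ≤ n
    · exact ⟨p, Finset.mem_Icc.2 ⟨hp1, h⟩, by omega, by omega⟩
    · exact ⟨n, Finset.mem_Icc.2 ⟨by omega, by omega⟩, by omega, by omega⟩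
  have hs' := Finset.mem_Icc.1 hs
  obtain ⟨x, hx⟩ : ∃ x, x ∈ blk n s := by
    by_cases h : s = 1
    · exact ⟨n, by rw [mem_blk]; omega⟩
    · exact ⟨1, by rw [mem_blk]; omega⟩
  have hpb : p ∉ blk n s := by rw [mem_blk]; omega
  have hqb : p + 1 ∉ blk n s := by rw [mem_blk]; omega
  have hpI : p ∈ Icc 1 (2 * n - 2) := Finset.mem_Icc.2 (by omega)
  have hqI : p + 1 ∈ Icc 1 (2 * n - 2) := Finset.mem_Icc.2 (by omega)
  obtain ⟨σ, hσ, -, -, hσp, hσq⟩ := exists_sched_blk hn hs hx hx hc hc (by simp)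
    (q := p) (q' := p + 1) (d := c) (d' := d) (by omega) (by omega) hc hd (by omega)
  have hσ' := hσ.swap_away hpI hqI (iff_of_false hpb hqb)
  have e1 := hK F R _ σ hF hR hσ (hA s hs)
  have e2 := hK F R _ _ hF hR hσ' (hA s hs)
  rw [total_tour hF hσ] at e1
  rw [total_tour hF hσ'] at e2
  have e3 := sum_sub_sum_of_eq_off_two (s := Icc 1 (2 * n - 2)) (p := p) (q := p + 1)
      hpI hqI (by omega)
      (fun r => slotWeight n a (F (σ r)) R (r ∈ blk n s) r)
      (fun r => slotWeight n a (F ((σ ∘ Equiv.swap p (p + 1)) r)) R (r ∈ blk n s) r)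
      (fun r hr h1 h2 => by
        simp only [Function.comp, Equiv.swap_apply_of_ne_of_ne h1 h2])
  simp only [Function.comp, Equiv.swap_apply_left, Equiv.swap_apply_right, hσp, hσq, hpb,
    hqb] at e1 e2 e3
  linarith

theorem exists_away_potential (hn : 4 ≤ n) (he : Even n)
    (hA : ∀ s ∈ Icc 1 n, Good (blk n s))
    (hK : ∀ F R H σ, OneFac n F → Orient t R → Sched n H σ → Good H →
      total n a (tour n F R H σ) = C) {p : ℕ} (hp : p ∈ Icc 1 (2 * n - 2)) :
    ∃ Λ : ℕ → ℝ, ∀ i ∈ Icc 1 n, ∀ j ∈ Icc 1 n, i ≠ j →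
      awayWeight t a p i j - awayWeight t a 1 i j = Λ i + Λ j := by
  have hD : ∀ p ∈ Icc 1 (2 * n - 2), ∀ q ∈ Icc 1 (2 * n - 2), ∀ i ∈ Icc 1 n, ∀ j ∈ Icc 1 n,
      i ≠ j → i ≠ t → j ≠ t → a p i j - a p j i = a q i j - a q j i := by
    intro p hp q hq i hi j hj hij hit hjt
    exact antisymm_const (b := 0) hn he hA (fun F R H σ h1 h2 h3 h4 => by
      simpa using hK F R H σ h1 h2 h3 h4) hi hj hij hit hjt hp hq
  have hsymm : ∀ p ∈ Icc 1 (2 * n - 2), ∀ q ∈ Icc 1 (2 * n - 2), ∀ i ∈ Icc 1 n,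
      ∀ j ∈ Icc 1 n, i ≠ j → awayWeight t a p i j - awayWeight t a q i j =
        awayWeight t a p j i - awayWeight t a q j i := by
    intro p hp q hq i hi j hj hij
    by_cases hit : i = t
    · subst hit; simp [awayWeight, hij.symm]
    · by_cases hjt : j = t
      · subst hjt; simp [awayWeight, hij]
      · simp only [awayWeight, hit, hjt, if_false]
        linarith [hD p hp q hq i hi j hj hij hit hjt]
  refine exists_potential hn (hsymm p hp 1 (Finset.mem_Icc.2 (by omega))) ?_
  intro x hx y hy z hz w hw hxy hxz hyz hwx hwy
  rw [Finset.mem_Icc] at hp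
  obtain ⟨hp1, hp2⟩ := hp
  induction p, hp1 using Nat.le_induction with
  | base => ring
  | succ p hp ih =>
    have hpI : p ∈ Icc 1 (2 * n - 2) := Finset.mem_Icc.2 (by omega)
    have hqI : p + 1 ∈ Icc 1 (2 * n - 2) := Finset.mem_Icc.2 (by omega)
    have h4 := four_point_of_matching hn he
      (G := fun i j => awayWeight t a p i j - awayWeight t a (p + 1) i j)
      (hsymm p hpI (p + 1) hqI) (fun F hF c hc d hd => by
        by_cases hcd : c = d
        · rw [hcd]
        have hR := orient_rk t 0 0
        have e := slotWeight_exchange hn hA hK hF hR hp hp2 hc hd hcd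
        have e1 := two_mul_slotWeight_sub (f := F c) hR (fun i hi => hF.mem hc hi)
          (fun i hi => hF.ne hc hi) (fun i hi => hF.inv hc hi) (hD p hpI (p + 1) hqI)
        have e2 := two_mul_slotWeight_sub (f := F d) hR (fun i hi => hF.mem hd hi)
          (fun i hi => hF.ne hd hi) (fun i hi => hF.inv hd hi) (hD p hpI (p + 1) hqI)
        rw [← e1, ← e2, e]) hx hy hz hw hxy hxz hyz hwx hwy
    have := ih (by omega)
    linarith

end Weights

theorem home_weight_eq_zero {n k : ℕ} {Good : Finset ℕ → Prop} {β : ℕ → ℕ → ℝ} {C : ℝ}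
    (hn : 4 ≤ n) (hk : k ∈ Icc 1 (n - 1)) (hA : ∀ s ∈ Icc 1 n, Good (blk n s))
    (hB : ∀ p ∈ Icc 1 (n - 1), p ≠ k → ∃ H q, (q = p ∨ q = p + n - 1) ∧
      H ⊆ Icc 1 (2 * n - 2) ∧ H.card = n - 1 ∧ Good H ∧
      ((k + n - 1 ∈ H ∧ q ∉ H ∧ Good (insert q (H.erase (k + n - 1)))) ∨
        (q ∈ H ∧ k + n - 1 ∉ H ∧ Good (insert (k + n - 1) (H.erase q)))))
    (hK : ∀ H σ, Sched n H σ → Good H →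
      ∑ p ∈ Icc 1 (2 * n - 2), (if p ∈ H then β p (σ p) else 0) = C)
    (h1 : ∀ c < n - 1, β 1 c = 0) :
    ∀ p ∈ Icc 1 (2 * n - 2), ∀ c < n - 1, β p c = 0 := by
  have move : ∀ H : Finset ℕ, H ⊆ Icc 1 (2 * n - 2) → H.card = n - 1 → Good H →
      ∀ p ∈ H, ∀ q ∈ Icc 1 (2 * n - 2), q ∉ H → Good (insert q (H.erase p)) →
      ∀ c < n - 1, β p c = β q c := by
    intro H hH hcard hG p hp q hq hqH hG' c hc
    have hpq : p ≠ q := fun e => hqH (e ▸ hp)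
    have hqd := Finset.mem_sdiff.2 ⟨hq, hqH⟩
    obtain ⟨σ, hσ, hσp, -, -, -⟩ := exists_sched hn hH hcard hp hp hc hc (by simp) hqd hqd hc hc
      (by simp)
    have e1 := hK H σ hσ hG
    have e2 := hK _ _ (hσ.move hp hq hqH) hG'
    have e3 := sum_sub_sum_of_eq_off_two (s := Icc 1 (2 * n - 2)) (hH hp) hq hpq
      (fun r => if r ∈ H then β r (σ r) else 0)
      (fun r => if r ∈ insert q (H.erase p) then β r ((σ ∘ Equiv.swap p q) r) else 0)
      (fun r hr h1 h2 => by
        simp only [Function.comp, Equiv.swap_apply_of_ne_of_ne h1 h2, Finset.mem_insert,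
          Finset.mem_erase, h1, h2, ne_eq, not_false_eq_true, true_and, false_or])
    have m : p ∉ insert q (H.erase p) := by simp [hpq]
    rw [e1, e2] at e3
    simp only [if_pos hp, if_neg hqH, if_neg m, if_pos (Finset.mem_insert_self q (H.erase p)),
      Function.comp, Equiv.swap_apply_right, hσp] at e3
    linarith
  have shift : ∀ s ∈ Icc 1 (n - 1), ∀ c < n - 1, β (s + n - 1) c = β s c := by
    intro s hs c hc
    have hs' := Finset.mem_Icc.1 hs
    have hsn : s ∈ Icc 1 n := Finset.mem_Icc.2 (by omega)
    refine move (blk n s) blk_subset (card_blk hn hsn) (hA s hsn) _ (by rw [mem_blk]; omega) s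
      (Finset.mem_Icc.2 (by omega)) (by rw [mem_blk]; omega) ?_ c hc
    rw [← blk_succ hn hs]
    exact hA _ (Finset.mem_Icc.2 (by omega))
  have low : ∀ p ∈ Icc 1 (n - 1), p ≠ k → ∀ c < n - 1, β p c = β k c := by
    intro p hp hpk c hc
    obtain ⟨H, q, hq, hH, hcard, hG, h⟩ := hB p hp hpk
    have hp' := Finset.mem_Icc.1 hp
    have hk' := Finset.mem_Icc.1 hk
    have hqI : q ∈ Icc 1 (2 * n - 2) := Finset.mem_Icc.2 (by omega)
    have hkI : k + n - 1 ∈ Icc 1 (2 * n - 2) := Finset.mem_Icc.2 (by omega)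
    have e : β q c = β (k + n - 1) c := by
      rcases h with ⟨h1, h2, h3⟩ | ⟨h1, h2, h3⟩
      · exact (move H hH hcard hG _ h1 q hqI h2 h3 c hc).symm
      · exact move H hH hcard hG _ h1 _ hkI h2 h3 c hc
    rw [shift k hk c hc] at e
    rw [← e]
    rcases hq with rfl | rfl
    · rfl
    · exact (shift p hp c hc).symm
  have hk0 : ∀ c < n - 1, β k c = 0 := by
    intro c hc
    by_cases hk1 : k = 1
    · rw [hk1]; exact h1 c hc
    · rw [← low 1 (Finset.mem_Icc.2 (by omega)) (Ne.symm hk1) c hc]; exact h1 c hc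
  have low0 : ∀ p ∈ Icc 1 (n - 1), ∀ c < n - 1, β p c = 0 := by
    intro p hp c hc
    by_cases hpk : p = k
    · rw [hpk]; exact hk0 c hc
    · rw [low p hp hpk c hc]; exact hk0 c hc
  intro p hp c hc
  rw [Finset.mem_Icc] at hp
  by_cases hpn : p ≤ n - 1
  · exact low0 p (Finset.mem_Icc.2 ⟨hp.1, hpn⟩) c hc
  · have hs : p - (n - 1) ∈ Icc 1 (n - 1) := Finset.mem_Icc.2 (by omega)
    have e := shift _ hs c hc
    rw [show p - (n - 1) + n - 1 = p by omega] at e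
    rw [e]; exact low0 _ hs c hc

theorem exists_form {n t k : ℕ} {Good : Finset ℕ → Prop} {a : ℕ → ℕ → ℕ → ℝ} {C : ℝ}
    (hn : 4 ≤ n) (he : Even n) (ht : t ∈ Icc 1 n) (hk : k ∈ Icc 1 (n - 1))
    (hA : ∀ s ∈ Icc 1 n, Good (blk n s))
    (hB : ∀ p ∈ Icc 1 (n - 1), p ≠ k → ∃ H q, (q = p ∨ q = p + n - 1) ∧
      H ⊆ Icc 1 (2 * n - 2) ∧ H.card = n - 1 ∧ Good H ∧
      ((k + n - 1 ∈ H ∧ q ∉ H ∧ Good (insert q (H.erase (k + n - 1)))) ∨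
        (q ∈ H ∧ k + n - 1 ∉ H ∧ Good (insert (k + n - 1) (H.erase q)))))
    (hK : ∀ F R H σ, OneFac n F → Orient t R → Sched n H σ → Good H →
      total n a (tour n F R H σ) = C) :
    ∃ μ Λ : ℕ → ℕ → ℝ, ∀ p ∈ Icc 1 (2 * n - 2), ∀ i ∈ Icc 1 n, ∀ j ∈ Icc 1 n, i ≠ j →
      a p i j = μ i j + Λ p i + Λ p j := by
  have hpot : ∀ p, ∃ Λ : ℕ → ℝ, p ∈ Icc 1 (2 * n - 2) → ∀ i ∈ Icc 1 n, ∀ j ∈ Icc 1 n, i ≠ j →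
      awayWeight t a p i j - awayWeight t a 1 i j = Λ i + Λ j := by
    intro p
    by_cases hp : p ∈ Icc 1 (2 * n - 2)
    · obtain ⟨Λ, hΛ⟩ := exists_away_potential hn he hA hK hp
      exact ⟨Λ, fun _ => hΛ⟩
    · exact ⟨0, fun h => absurd h hp⟩
  choose Λ hΛ using hpot
  set a' : ℕ → ℕ → ℕ → ℝ := fun p i j => a p i j - (a 1 i j + Λ p i + Λ p j) with ha'
  have hI1 : 1 ∈ Icc 1 (2 * n - 2) := Finset.mem_Icc.2 (by omega)
  have h0 : ∀ p ∈ Icc 1 (2 * n - 2), ∀ i ∈ Icc 1 n, ∀ j ∈ Icc 1 n, i ≠ j → i ≠ t →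
      a' p i j = 0 := by
    intro p hp i hi j hj hij hit
    have := hΛ p hp i hi j hj hij
    simp only [awayWeight, hit, if_false] at this
    simp only [ha']
    linarith
  have hF := oneFac_canonFac hn he
  set F := canonFac n
  have hR := orient_rk t 0 0
  set R := fun x y => rk t 0 0 x < rk t 0 0 y
  have hw : ∀ c < n - 1, ∀ h : Prop, ∀ p ∈ Icc 1 (2 * n - 2), slotWeight n a' (F c) R h p =
      if h then a' p t (F c t) else 0 := by
    intro c hc h p hp
    rw [slotWeight, Finset.sum_eq_single t]
    · have := hR.top (hF.ne hc ht)
      by_cases hh : h <;> simp [this, hh]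
    · intro i hi hit
      rw [h0 p hp i hi _ (hF.mem hc hi) (hF.ne hc hi).symm hit, ite_self]
    · exact fun h => absurd ht h
  have hform : ∀ T, total n a T = total n a' T +
      total n (fun p i j => a 1 i j + Λ p i + Λ p j) T := by
    intro T
    simp only [total, ← Finset.sum_add_distrib]
    refine Finset.sum_congr rfl fun p _ => Finset.sum_congr rfl fun i _ =>
      Finset.sum_congr rfl fun j _ => ?_
    split_ifs
    · simp only [ha']; ring
    · simp
  have hzero := home_weight_eq_zero (β := fun p c => a' p t (F c t)) hn hk hA hB
    (C := C - (∑ i ∈ Icc 1 n, ∑ j ∈ Icc 1 n, (if i ≠ j then a 1 i j else 0) +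
      ∑ p ∈ Icc 1 (2 * n - 2), ∑ s ∈ Icc 1 n, Λ p s)) (fun H σ hσ hG => by
    have e := hK F R H σ hF hR hσ hG
    rw [hform, total_eq_of_form (fun _ _ _ _ _ _ _ => rfl) (isTournament_tour hF hR hσ),
      total_tour hF hσ] at e
    rw [← e, add_sub_cancel_right]
    exact Finset.sum_congr rfl fun p hp => by rw [hw _ (hσ.lt hp) _ p hp]; congr) (fun c hc => by
    have := hΛ 1 hI1 t ht _ (hF.mem hc ht) (hF.ne hc ht).symm
    simp only [ha']
    linarith)
  refine ⟨a 1, Λ, fun p hp i hi j hj hij => ?_⟩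
  suffices a' p i j = 0 by simp only [ha'] at this; linarith
  by_cases hit : i = t
  · subst hit
    obtain ⟨c, hc, rfl⟩ := hF.ex hi hj hij
    exact hzero p hp c hc
  · exact h0 p hp i hi j hj hij hit

instance finite_isMatch (n : ℕ) : Finite {m : ℕ × ℕ × ℕ // IsMatch n m} := by
  refine ((Icc 1 (2 * n - 2) ×ˢ Icc 1 n ×ˢ Icc 1 n).finite_toSet.subset fun m hm => ?_)
  simp only [Finset.coe_product, Finset.coe_Icc, Set.mem_prod, Set.mem_Icc]
  obtain ⟨h1, h2, h3, h4, h5, h6, -⟩ := hm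
  exact ⟨⟨h1, h2⟩, ⟨h3, h4⟩, h5, h6⟩

instance finite_isTravelIdx (n : ℕ) : Finite {p : ℕ × ℕ × ℕ // IsTravelIdx n p} := by
  refine ((Icc 1 n ×ˢ Icc 1 n ×ˢ Icc 1 n).finite_toSet.subset fun m hm => ?_)
  simp only [Finset.coe_product, Finset.coe_Icc, Set.mem_prod, Set.mem_Icc]
  obtain ⟨h1, h2, h3, h4, h5, h6, -⟩ := hm
  exact ⟨⟨h1, h2⟩, ⟨h3, h4⟩, h5, h6⟩

theorem adim_face {n : ℕ} {G P F : Set (Pt n)} (hP : P = convexHull ℝ G)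
    (hFP : F ⊆ P) (f : Pt n →ₗ[ℝ] ℝ) (γ : ℝ) (hf : ∀ z ∈ F, f z = γ) (v : Pt n)
    {z z' : Pt n} (hz : z ∈ P) (hz' : z' ∈ P) (hne : f z ≠ f z')
    (h : ∀ ℓ : Pt n →ₗ[ℝ] ℝ, ℓ v = 0 → (∀ x ∈ F, ∀ y ∈ F, ℓ x = ℓ y) →
      ∀ x ∈ G, ∀ y ∈ G, ℓ x = ℓ y) :
    adim F + 1 = adim P := by
  have hker : ∀ (ℓ : Pt n →ₗ[ℝ] ℝ) (S : Set (Pt n)), (∀ x ∈ S, ∀ y ∈ S, ℓ x = ℓ y) →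
      vectorSpan ℝ S ≤ LinearMap.ker ℓ := by
    intro ℓ S hS
    rw [vectorSpan_def, Submodule.span_le]
    rintro _ ⟨x, hx, y, hy, rfl⟩
    simp [hS x hx y hy]
  have hPG : vectorSpan ℝ P = vectorSpan ℝ G := by
    rw [← direction_affineSpan, ← direction_affineSpan, hP, affineSpan_convexHull]
  unfold adim
  rw [direction_affineSpan, direction_affineSpan]
  have hle : vectorSpan ℝ F ≤ vectorSpan ℝ P := vectorSpan_mono ℝ hFP
  have hlt : vectorSpan ℝ F < vectorSpan ℝ P := by
    refine lt_of_le_of_ne hle fun e => hne ?_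
    have h1 := vsub_mem_vectorSpan ℝ hz hz'
    rw [← e] at h1
    have h2 := hker f F (fun x hx y hy => (hf x hx).trans (hf y hy).symm) h1
    rwa [LinearMap.mem_ker, vsub_eq_sub, map_sub, sub_eq_zero] at h2
  have hup : vectorSpan ℝ P ≤ vectorSpan ℝ F ⊔ Submodule.span ℝ {v} := by
    intro x hx
    by_contra hx'
    obtain ⟨ℓ, hℓ, hm⟩ := Submodule.exists_le_ker_of_notMem hx'
    refine hℓ ?_
    rw [sup_le_iff, Submodule.span_singleton_le_iff_mem] at hm
    have := hker ℓ G (h ℓ hm.2 fun x hx y hy => by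
      have := hm.1 (vsub_mem_vectorSpan ℝ hx hy)
      rwa [LinearMap.mem_ker, vsub_eq_sub, map_sub, sub_eq_zero] at this)
    exact this (hPG ▸ hx)
  have h1 := Submodule.finrank_lt_finrank_of_lt hlt
  have h2 := Submodule.finrank_mono hup
  have h3 := Submodule.finrank_add_le_finrank_add_finrank (vectorSpan ℝ F) (Submodule.span ℝ {v})
  have h4 := finrank_span_finset_le_card (R := ℝ) {v}
  rw [Finset.coe_singleton, Finset.card_singleton] at h4
  have h5 := h2.trans (h3.trans (Nat.add_le_add_left h4 _))
  omega

/-- The unit vector of the play coordinate `m`, which is zero if `m` is no match. -/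
noncomputable def playVec (n : ℕ) (m : ℕ × ℕ × ℕ) : Pt n := (fun q => if q.1 = m then 1 else 0, 0)

/-- The unit vector of the travel coordinate `p`, which is zero if `p` is no travel index. -/
noncomputable def travelVec (n : ℕ) (p : ℕ × ℕ × ℕ) : Pt n := (0, fun q => if q.1 = p then 1 else 0)

theorem sum_ite_triple {A B C : Finset ℕ} {m : ℕ × ℕ × ℕ} (h1 : m.1 ∈ A) (h2 : m.2.1 ∈ B)
    (h3 : m.2.2 ∈ C) (f : ℕ → ℕ → ℕ → ℝ) :
    ∑ p ∈ A, ∑ i ∈ B, ∑ j ∈ C, f p i j * (if m = (p, i, j) then 1 else 0) = f m.1 m.2.1 m.2.2 := by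
  rw [Finset.sum_eq_single m.1, Finset.sum_eq_single m.2.1, Finset.sum_eq_single m.2.2]
  · simp
  · intro j _ hj
    rw [if_neg, mul_zero]
    exact fun h => hj (congrArg (fun m => m.2.2) h).symm
  · exact fun h => absurd h3 h
  · intro i _ hi
    refine Finset.sum_eq_zero fun j _ => ?_
    rw [if_neg, mul_zero]
    exact fun h => hi (congrArg (fun m => m.2.1) h).symm
  · exact fun h => absurd h2 h
  · intro p _ hp
    refine Finset.sum_eq_zero fun i _ => Finset.sum_eq_zero fun j _ => ?_
    rw [if_neg, mul_zero]
    exact fun h => hp (congrArg Prod.fst h).symm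
  · exact fun h => absurd h1 h

theorem apply_eq_sum {n : ℕ} (ℓ : Pt n →ₗ[ℝ] ℝ) (z : Pt n) :
    ℓ z = ∑ p ∈ Icc 1 (2 * n - 2), ∑ i ∈ Icc 1 n, ∑ j ∈ Icc 1 n,
        xval z p i j * ℓ (playVec n (p, i, j)) +
      ∑ s ∈ Icc 1 n, ∑ i ∈ Icc 1 n, ∑ j ∈ Icc 1 n, yval z s i j * ℓ (travelVec n (s, i, j)) := by
  have hz : z = ∑ p ∈ Icc 1 (2 * n - 2), ∑ i ∈ Icc 1 n, ∑ j ∈ Icc 1 n,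
        xval z p i j • playVec n (p, i, j) +
      ∑ s ∈ Icc 1 n, ∑ i ∈ Icc 1 n, ∑ j ∈ Icc 1 n, yval z s i j • travelVec n (s, i, j) := by
    refine Prod.ext (funext fun q => ?_) (funext fun q => ?_)
    · obtain ⟨h1, h2, h3, h4, h5, h6, -⟩ := q.2
      simp only [playVec, travelVec, Prod.fst_add, Prod.fst_sum, Prod.smul_fst, Pi.add_apply,
        Finset.sum_apply, Pi.smul_apply, smul_eq_mul, smul_zero, Finset.sum_const_zero, Pi.zero_apply,
        add_zero]
      rw [sum_ite_triple (Finset.mem_Icc.2 ⟨h1, h2⟩) (Finset.mem_Icc.2 ⟨h3, h4⟩)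
        (Finset.mem_Icc.2 ⟨h5, h6⟩)]
      rw [xval, dif_pos q.2]
    · obtain ⟨h1, h2, h3, h4, h5, h6, -⟩ := q.2
      simp only [playVec, travelVec, Prod.snd_add, Prod.snd_sum, Prod.smul_snd, Pi.add_apply,
        Finset.sum_apply, Pi.smul_apply, smul_eq_mul, smul_zero, Finset.sum_const_zero, Pi.zero_apply,
        zero_add]
      rw [sum_ite_triple (Finset.mem_Icc.2 ⟨h1, h2⟩) (Finset.mem_Icc.2 ⟨h3, h4⟩)
        (Finset.mem_Icc.2 ⟨h5, h6⟩)]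
      rw [yval, dif_pos q.2]
  conv_lhs => rw [hz]
  simp only [map_add, map_sum, map_smul, smul_eq_mul]

/-- The generators of the polytope `Ptt n`. -/
def generators (n : ℕ) : Set (Pt n) :=
  { z : Pt n | ∃ T : Set (ℕ × ℕ × ℕ), IsTournament n T ∧
    (∀ m : {m : ℕ × ℕ × ℕ // IsMatch n m}, z.1 m = play T m.1) ∧
    (∀ p : {p : ℕ × ℕ × ℕ // IsTravelIdx n p}, z.2 p = 0 ∨ z.2 p = 1) ∧
    (∀ p : {p : ℕ × ℕ × ℕ // IsTravelIdx n p}, travel n T p.1 ≤ z.2 p) }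

theorem travelVec_self {n i : ℕ} (s : ℕ) : travelVec n (s, i, i) = 0 := by
  refine Prod.ext rfl (funext fun q => if_neg fun h => ?_)
  have := q.2.2.2.2.2.2.2
  rw [h] at this
  exact this rfl

theorem apply_generator {n t : ℕ} (ht : t ∈ Icc 1 n) (ℓ : Pt n →ₗ[ℝ] ℝ)
    (hℓ : ∀ s ∈ Icc 1 n, ∀ i ∈ Icc 1 n, ∀ j ∈ Icc 1 n, i ≠ j → ¬(s = t ∧ i = t) →
      ℓ (travelVec n (s, i, j)) = 0)
    {T : Set (ℕ × ℕ × ℕ)} (hT : IsTournament n T) {z : Pt n} (hz : ∀ m, z.1 m = play T m.1) :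
    ℓ z = total n (fun p i j => ℓ (playVec n (p, i, j))) T +
      ∑ j ∈ Icc 1 n \ {t}, yval z t t j * ℓ (travelVec n (t, t, j)) := by
  rw [apply_eq_sum ℓ z]
  congr 1
  · refine Finset.sum_congr rfl fun p _ => Finset.sum_congr rfl fun i _ =>
      Finset.sum_congr rfl fun j _ => ?_
    split_ifs with h
    · rw [xval, dif_pos (hT.subset _ h), hz, play, if_pos h, one_mul]
    · rw [xval]
      split_ifs with h'
      · rw [hz, play, if_neg h, zero_mul]
      · rw [zero_mul]
  · have hz' : ∀ s ∈ Icc 1 n, ∀ i ∈ Icc 1 n, ∀ j ∈ Icc 1 n, ¬(s = t ∧ i = t) →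
        yval z s i j * ℓ (travelVec n (s, i, j)) = 0 := by
      intro s hs i hi j hj h
      by_cases hij : i = j
      · rw [hij, travelVec_self, map_zero, mul_zero]
      · rw [hℓ s hs i hi j hj hij h, mul_zero]
    rw [Finset.sum_eq_single t, Finset.sum_eq_single t, Finset.sdiff_singleton_eq_erase,
      ← Finset.add_sum_erase _ _ ht, travelVec_self, map_zero, mul_zero, zero_add]
    · exact fun i hi hit => Finset.sum_eq_zero fun j hj => hz' t ht i hi j hj fun h => hit h.2
    · exact fun h => absurd ht h
    · exact fun s hs hst => Finset.sum_eq_zero fun i hi => Finset.sum_eq_zero fun j hj =>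
        hz' s hs i hi j hj fun h => hst h.1
    · exact fun h => absurd ht h

/-- The slots in which team `t` plays at home. -/
noncomputable def homeSlots (n : ℕ) (T : Set (ℕ × ℕ × ℕ)) (t : ℕ) : Finset ℕ :=
  (Icc 1 (2 * n - 2)).filter fun p => ∃ j, (p, t, j) ∈ T

theorem mem_homeSlots {n t p : ℕ} {T : Set (ℕ × ℕ × ℕ)} (hT : IsTournament n T) :
    p ∈ homeSlots n T t ↔ ∃ j, (p, t, j) ∈ T := by
  rw [homeSlots, Finset.mem_filter, Finset.mem_Icc, and_iff_right_iff_imp]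
  rintro ⟨j, hj⟩
  have := hT.subset _ hj
  exact ⟨this.1, this.2.1⟩

theorem IsTournament.mem_Icc {n p i j : ℕ} {T : Set (ℕ × ℕ × ℕ)} (hT : IsTournament n T)
    (h : (p, i, j) ∈ T) : p ∈ Icc 1 (2 * n - 2) ∧ i ∈ Icc 1 n ∧ j ∈ Icc 1 n ∧ i ≠ j := by
  obtain ⟨h1, h2, h3, h4, h5, h6, h7⟩ := hT.subset _ h
  simp only [Finset.mem_Icc]
  exact ⟨⟨h1, h2⟩, ⟨h3, h4⟩, ⟨h5, h6⟩, h7⟩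

theorem IsTournament.eq_of_mem {n p s i j i' j' : ℕ} {T : Set (ℕ × ℕ × ℕ)} (hT : IsTournament n T)
    (h : (p, i, j) ∈ T) (h' : (p, i', j') ∈ T) (hs : s = i ∨ s = j) (hs' : s = i' ∨ s = j') :
    i = i' ∧ j = j' := by
  obtain ⟨hp, hi, hj, -⟩ := hT.mem_Icc h
  have hsm : s ∈ Icc 1 n := by rcases hs with rfl | rfl <;> assumption
  rw [Finset.mem_Icc] at hp hsm
  have := (hT.slot_team p hp.1 hp.2 s hsm.1 hsm.2).unique ⟨h, rfl, hs⟩ ⟨h', rfl, hs'⟩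
  simpa using this

theorem IsTournament.venue_eq {n p s i j : ℕ} {T : Set (ℕ × ℕ × ℕ)} (hT : IsTournament n T)
    (h : (p, i, j) ∈ T) (hs : s = i ∨ s = j) : venue T s p = i := by
  have hex : ∃ i, ∃ j, (p, i, j) ∈ T ∧ (s = i ∨ s = j) := ⟨i, j, h, hs⟩
  rw [venue, dif_pos hex]
  obtain ⟨j', hj', hs'⟩ := hex.choose_spec
  exact (hT.eq_of_mem hj' h hs' hs).1

theorem IsTournament.venue_of_notMem {n p s : ℕ} {T : Set (ℕ × ℕ × ℕ)} (hT : IsTournament n T)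
    (h : p ∉ Icc 1 (2 * n - 2)) : venue T s p = s := by
  rw [venue, dif_neg]
  rintro ⟨i, j, hm, -⟩
  exact h (hT.mem_Icc hm).1

theorem IsTournament.venue_home {n p s : ℕ} {T : Set (ℕ × ℕ × ℕ)} (hT : IsTournament n T)
    (h : p ∈ homeSlots n T s) : venue T s p = s := by
  obtain ⟨j, hj⟩ := (mem_homeSlots hT).1 h
  exact hT.venue_eq hj (Or.inl rfl)

theorem IsTournament.mem_away {n p s : ℕ} {T : Set (ℕ × ℕ × ℕ)} (hT : IsTournament n T)
    (hs : s ∈ Icc 1 n) (hp : p ∈ Icc 1 (2 * n - 2)) (h : p ∉ homeSlots n T s) :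
    (p, venue T s p, s) ∈ T := by
  rw [Finset.mem_Icc] at hs hp
  obtain ⟨⟨q, i, j⟩, ⟨hm, hq, hij⟩, -⟩ := hT.slot_team p hp.1 hp.2 s hs.1 hs.2
  simp only at hq hij
  subst hq
  rw [hT.venue_eq hm hij]
  rcases hij with rfl | rfl
  · exact absurd ((mem_homeSlots hT).2 ⟨j, hm⟩) h
  · exact hm

theorem IsTournament.travel_eq_sum {n t j : ℕ} {T : Set (ℕ × ℕ × ℕ)} (hT : IsTournament n T)
    (ht : t ∈ Icc 1 n) (hj : j ≠ t) :
    travel n T (t, t, j) =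
      ∑ r ∈ dep n (homeSlots n T t), if venue T t (r + 1) = j then 1 else 0 := by
  have hin : ∀ r ∈ dep n (homeSlots n T t), (r + 1, venue T t (r + 1), t) ∈ T := by
    intro r hr
    rw [mem_dep] at hr
    exact hT.mem_away ht (Finset.mem_Icc.2 (by omega)) hr.2.2
  rw [travel]
  split_ifs with h
  · obtain ⟨r, -, h1, h2⟩ := h
    simp only at h1 h2
    have hr1 : r + 1 ∈ Icc 1 (2 * n - 2) := by
      by_contra h
      exact hj (h2.symm.trans (hT.venue_of_notMem h))
    have hr2 : r + 1 ∉ homeSlots n T t := fun h => hj (h2.symm.trans (hT.venue_home h))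
    have hr0 : r = 0 ∨ r ∈ homeSlots n T t := by
      by_contra! h
      have hm := hT.mem_away ht (p := r) (by rw [Finset.mem_Icc] at hr1 ⊢; omega) h.2
      rw [h1] at hm
      exact (hT.mem_Icc hm).2.2.2 rfl
    have hr : r ∈ dep n (homeSlots n T t) := by
      rw [Finset.mem_Icc] at hr1
      exact mem_dep.2 ⟨by omega, hr0, hr2⟩
    rw [Finset.sum_eq_single r, if_pos h2]
    · intro q hq hqr
      refine if_neg fun hv => hqr ?_
      have e1 := hin q hq
      have e2 := hin r hr
      rw [hv] at e1
      rw [h2] at e2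
      obtain ⟨-, h3, h4, h5⟩ := hT.mem_Icc e1
      rw [Finset.mem_Icc] at h3 h4
      have := (hT.pair j t h3.1 h3.2 h4.1 h4.2 h5).unique e1 e2
      omega
    · exact fun h => absurd hr h
  · refine (Finset.sum_eq_zero fun r hr => if_neg fun hv => h ⟨r, ?_, ?_, hv⟩).symm
    · rw [mem_dep] at hr; omega
    · rcases (mem_dep.1 hr).2.1 with h0 | h0
      · rw [h0]
        exact hT.venue_of_notMem (by simp)
      · exact hT.venue_home h0

theorem IsTournament.sum_travel {n t : ℕ} {T : Set (ℕ × ℕ × ℕ)} (hT : IsTournament n T)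
    (ht : t ∈ Icc 1 n) (b : ℕ → ℝ) :
    ∑ j ∈ Icc 1 n \ {t}, travel n T (t, t, j) * b j =
      ∑ r ∈ dep n (homeSlots n T t), b (venue T t (r + 1)) := by
  rw [Finset.sum_congr rfl fun j hj => by
    rw [hT.travel_eq_sum ht (by simpa using (Finset.mem_sdiff.1 hj).2), Finset.sum_mul],
    Finset.sum_comm]
  refine Finset.sum_congr rfl fun r hr => ?_
  rw [mem_dep] at hr
  have hm := hT.mem_Icc (hT.mem_away ht (p := r + 1) (Finset.mem_Icc.2 (by omega)) hr.2.2)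
  rw [Finset.sum_eq_single (venue T t (r + 1)), if_pos rfl, one_mul]
  · exact fun j _ hj => by rw [if_neg (Ne.symm hj), zero_mul]
  · intro h
    rw [Finset.mem_sdiff, Finset.mem_singleton] at h
    exact absurd ⟨hm.2.1, hm.2.2.2⟩ h

section Play

variable {n t p : ℕ} {T : Set (ℕ × ℕ × ℕ)} {z : Pt n}

theorem xval_eq (hT : IsTournament n T) (hz : ∀ m, z.1 m = play T m.1) (p i j : ℕ) :
    xval z p i j = if (p, i, j) ∈ T then 1 else 0 := by
  rw [xval]
  split_ifs with h1 h2 h2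
  · rw [hz, play, if_pos h2]
  · rw [hz, play, if_neg h2]
  · exact absurd (hT.subset _ h2) h1
  · rfl

theorem sum_xval_home (hT : IsTournament n T) (hz : ∀ m, z.1 m = play T m.1) :
    ∑ j ∈ Icc 1 n \ {t}, xval z p t j = if p ∈ homeSlots n T t then 1 else 0 := by
  simp only [xval_eq hT hz, mem_homeSlots hT]
  split_ifs with h
  · obtain ⟨j, hj⟩ := h
    obtain ⟨-, -, h3, h4⟩ := hT.mem_Icc hj
    rw [Finset.sum_eq_single_of_mem j
      (by rw [Finset.mem_sdiff, Finset.mem_singleton]; exact ⟨h3, h4.symm⟩), if_pos hj]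
    exact fun i _ hi => if_neg fun h => hi (hT.eq_of_mem h hj (Or.inl rfl) (Or.inl rfl)).2
  · exact Finset.sum_eq_zero fun j _ => if_neg fun hj => h ⟨j, hj⟩

theorem sum_xval_away (hT : IsTournament n T) (hz : ∀ m, z.1 m = play T m.1) (ht : t ∈ Icc 1 n)
    (hp : p ∈ Icc 1 (2 * n - 2)) :
    ∑ j ∈ Icc 1 n \ {t}, xval z p j t = if p ∉ homeSlots n T t then 1 else 0 := by
  simp only [xval_eq hT hz]
  split_ifs with h
  · rw [mem_homeSlots hT] at h
    obtain ⟨j, hj⟩ := h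
    refine Finset.sum_eq_zero fun i _ => if_neg fun hi => ?_
    exact (hT.mem_Icc hi).2.2.2 (hT.eq_of_mem hi hj (Or.inr rfl) (Or.inl rfl)).1
  · have hj := hT.mem_away ht hp h
    obtain ⟨-, h3, -, h4⟩ := hT.mem_Icc hj
    rw [Finset.sum_eq_single_of_mem _ 
      (by rw [Finset.mem_sdiff, Finset.mem_singleton]; exact ⟨h3, h4⟩), if_pos hj]
    exact fun i _ hi => if_neg fun h' => hi (hT.eq_of_mem h' hj (Or.inr rfl) (Or.inr rfl)).1

theorem card_homeSlots (hT : IsTournament n T) (ht : t ∈ Icc 1 n) :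
    (homeSlots n T t).card = n - 1 := by
  obtain ⟨z, hz⟩ : ∃ z : Pt n, ∀ m, z.1 m = play T m.1 := ⟨(fun m => play T m.1, 0), fun _ => rfl⟩
  have hsub : homeSlots n T t ⊆ Icc 1 (2 * n - 2) := Finset.filter_subset _ _
  have h1 : ∑ p ∈ Icc 1 (2 * n - 2), ∑ j ∈ Icc 1 n \ {t}, xval z p t j =
      (homeSlots n T t).card := by
    simp only [sum_xval_home hT hz]
    rw [Finset.sum_ite_mem, Finset.sum_const, nsmul_eq_mul, mul_one,
      Finset.inter_eq_right.2 hsub]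
  rw [Finset.sum_comm] at h1
  simp only [xval_eq hT hz] at h1
  rw [Finset.sum_congr rfl fun j hj => hT.sum_pair ht (Finset.mem_sdiff.1 hj).1
    (fun e => (Finset.mem_sdiff.1 hj).2 (Finset.mem_singleton.2 e.symm)) 1, Finset.sum_const,
    nsmul_eq_mul, mul_one, Finset.sdiff_singleton_eq_erase, Finset.card_erase_of_mem ht,
    Nat.card_Icc] at h1
  exact_mod_cast h1.symm

end Play

theorem homeSlots_tour {n t : ℕ} {F : ℕ → ℕ → ℕ} {R : ℕ → ℕ → Prop} {H : Finset ℕ} {σ : ℕ → ℕ}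
    (hF : OneFac n F) (hR : Orient t R) (hσ : Sched n H σ) (ht : t ∈ Icc 1 n) :
    homeSlots n (tour n F R H σ) t = H := by
  ext p
  rw [mem_homeSlots (isTournament_tour hF hR hσ)]
  simp only [mem_tour]
  constructor
  · rintro ⟨j, hp, -, rfl, h⟩
    exact h.2 (hR.top (hF.ne (hσ.lt hp) ht))
  · intro hp
    have hp' := hσ.sub hp
    exact ⟨_, hp', ht, rfl, iff_of_true hp (hR.top (hF.ne (hσ.lt hp') ht))⟩

theorem mem_tour_opponent {n t s p : ℕ} {F : ℕ → ℕ → ℕ} {R : ℕ → ℕ → Prop} {H : Finset ℕ}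
    {σ : ℕ → ℕ} (hF : OneFac n F) (hR : Orient t R) (hσ : Sched n H σ) (hs : s ∈ Icc 1 n)
    (hp : p ∈ Icc 1 (2 * n - 2)) (h : ¬(p ∈ H ↔ R s (F (σ p) s))) :
    (p, F (σ p) s, s) ∈ tour n F R H σ := by
  have hc := hσ.lt hp
  refine mem_tour.2 ⟨hp, hF.mem hc hs, (hF.inv hc hs).symm, ?_⟩
  have := hR.tot (hF.ne hc hs)
  tauto

theorem sum_travel_tour {n t : ℕ} {F : ℕ → ℕ → ℕ} {R : ℕ → ℕ → Prop} {H : Finset ℕ} {σ : ℕ → ℕ}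
    (hF : OneFac n F) (hR : Orient t R) (hσ : Sched n H σ) (ht : t ∈ Icc 1 n) (b : ℕ → ℝ) :
    ∑ j ∈ Icc 1 n \ {t}, travel n (tour n F R H σ) (t, t, j) * b j =
      ∑ r ∈ dep n H, b (F (σ (r + 1)) t) := by
  have hT := isTournament_tour hF hR hσ
  rw [hT.sum_travel ht, homeSlots_tour hF hR hσ ht]
  refine Finset.sum_congr rfl fun r hr => ?_
  rw [mem_dep] at hr
  have hp : r + 1 ∈ Icc 1 (2 * n - 2) := Finset.mem_Icc.2 (by omega)
  rw [hT.venue_eq (mem_tour_opponent hF hR hσ ht hp fun h =>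
    hr.2.2 (h.2 (hR.top (hF.ne (hσ.lt hp) ht)))) (Or.inr rfl)]

/-- The number of the slots `k` and `k+n-1` that lie in `H` (if `A` holds) or outside of `H`. -/
noncomputable def hits (n k : ℕ) (A : Prop) (H : Finset ℕ) : ℕ :=
  (if (k ∈ H ↔ A) then 1 else 0) + (if (k + n - 1 ∈ H ↔ A) then 1 else 0)

theorem exists_dep {n a b : ℕ} {H : Finset ℕ} (hab : a < b) (hb : b ≤ 2 * n - 2)
    (ha : a = 0 ∨ a ∈ H) (hbH : b ∉ H) : ∃ r ∈ dep n H, a ≤ r ∧ r < b := by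
  have hex : ∃ r, a ≤ r ∧ r + 1 ∉ H := ⟨b - 1, by omega, by rwa [Nat.sub_add_cancel (by omega)]⟩
  have hle : Nat.find hex ≤ b - 1 :=
    Nat.find_min' hex ⟨by omega, by rwa [Nat.sub_add_cancel (by omega)]⟩
  obtain ⟨h1, h2⟩ := Nat.find_spec hex
  refine ⟨Nat.find hex, mem_dep.2 ⟨by omega, ?_, h2⟩, h1, by omega⟩
  rcases h1.eq_or_lt with h | h
  · rwa [← h]
  · have := Nat.find_min hex (m := Nat.find hex - 1) (by omega)
    rw [Nat.sub_add_cancel (by omega), not_and, not_not] at this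
    exact Or.inr (this (by omega))

section Hits

variable {n k : ℕ}

theorem two_le_hits (hn : 4 ≤ n) (hk : k ∈ Icc 1 (n - 1)) (A : Prop) {H : Finset ℕ}
    (hH : H ⊆ Icc 1 (2 * n - 2)) (hcard : H.card = n - 1) : 2 ≤ (dep n H).card + hits n k A H := by
  rw [Finset.mem_Icc] at hk
  have hw : (Icc k (k + n - 1)).card = n := by rw [Nat.card_Icc]; omega
  have hws : Icc k (k + n - 1) ⊆ Icc 1 (2 * n - 2) := Finset.Icc_subset_Icc (by omega) (by omega)
  have haway : (Icc 1 (2 * n - 2) \ H).card = n - 1 := by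
    rw [Finset.card_sdiff_of_subset hH, hcard, Nat.card_Icc]; omega
  obtain ⟨u, hu, huH⟩ : ∃ u ∈ Icc k (k + n - 1), u ∉ H :=
    Finset.exists_mem_notMem_of_card_lt_card (by omega)
  obtain ⟨h, hh, hhH⟩ : ∃ h ∈ Icc k (k + n - 1), h ∈ H := by
    by_contra! hc
    have := Finset.card_le_card (t := Icc 1 (2 * n - 2) \ H) fun x hx =>
      Finset.mem_sdiff.2 ⟨hws hx, hc x hx⟩
    omega
  rw [Finset.mem_Icc] at hu hh
  by_cases h0 : (k ∈ H ↔ A) ∨ (k + n - 1 ∈ H ↔ A)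
  · obtain ⟨r, hr, -⟩ := exists_dep (n := n) (a := 0) (b := u) (by omega) (by omega) (Or.inl rfl) huH
    have h1 : 1 ≤ (dep n H).card := Finset.card_pos.2 ⟨r, hr⟩
    have h2 : 1 ≤ hits n k A H := by
      unfold hits
      rcases h0 with h0 | h0 <;> rw [if_pos h0] <;> omega
    omega
  · rw [not_or] at h0
    refine le_trans ?_ (Nat.le_add_right _ _)
    suffices ∃ r ∈ dep n H, ∃ r' ∈ dep n H, r < r' by
      obtain ⟨r, hr, r', hr', hlt⟩ := this
      exact Finset.one_lt_card.2 ⟨r, hr, r', hr', hlt.ne⟩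
    by_cases hA : A
    · simp only [hA, iff_true] at h0
      have hk' : h ≠ k := fun e => h0.1 (e ▸ hhH)
      have hk'' : h ≠ k + n - 1 := fun e => h0.2 (e ▸ hhH)
      obtain ⟨r, hr, hr1, hr2⟩ := exists_dep (n := n) (a := 0) (b := k) (by omega) (by omega)
        (Or.inl rfl) h0.1
      obtain ⟨r', hr', hr1', hr2'⟩ := exists_dep (n := n) (a := h) (b := k + n - 1) (by omega)
        (by omega) (Or.inr hhH) h0.2
      exact ⟨r, hr, r', hr', by omega⟩
    · simp only [hA, iff_false, not_not] at h0
      have hk' : u ≠ k := fun e => huH (e ▸ h0.1)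
      obtain ⟨r, hr, hr1, hr2⟩ := exists_dep (n := n) (a := k) (b := u) (by omega) (by omega)
        (Or.inr h0.1) huH
      obtain ⟨w, hw, hwo⟩ : ∃ w ∈ Icc 1 (2 * n - 2) \ H, w ∉ Icc (k + 1) (k + n - 2) := by
        refine Finset.exists_mem_notMem_of_card_lt_card ?_
        rw [haway, Nat.card_Icc]; omega
      rw [Finset.mem_sdiff, Finset.mem_Icc] at hw
      rw [Finset.mem_Icc] at hwo
      have hw1 : w ≠ k := fun e => hw.2 (e ▸ h0.1)
      have hw2 : w ≠ k + n - 1 := fun e => hw.2 (e ▸ h0.2)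
      rcases lt_or_ge w k with hlt | hge
      · obtain ⟨r', hr', hr1', hr2'⟩ := exists_dep (n := n) (a := 0) (b := w) (by omega) (by omega)
          (Or.inl rfl) hw.2
        exact ⟨r', hr', r, hr, by omega⟩
      · obtain ⟨r', hr', hr1', hr2'⟩ := exists_dep (n := n) (a := k + n - 1) (b := w) (by omega)
          (by omega) (Or.inr h0.2) hw.2
        exact ⟨r, hr, r', hr', by omega⟩

theorem hits_blk (hn : 4 ≤ n) (hk : k ∈ Icc 1 (n - 1)) (A : Prop) {s : ℕ} (hs : s ∈ Icc 1 n) :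
    (dep n (blk n s)).card + hits n k A (blk n s) = 2 := by
  rw [dep_blk hn hs, Finset.card_singleton, hits]
  simp only [mem_blk]
  rw [Finset.mem_Icc] at hk hs
  rcases le_or_gt s k with h | h
  · have h1 : ¬ ((1 ≤ k ∧ k ≤ 2 * n - 2) ∧ ¬(s ≤ k ∧ k ≤ s + n - 2)) := by omega
    have h2 : (1 ≤ k + n - 1 ∧ k + n - 1 ≤ 2 * n - 2) ∧ ¬(s ≤ k + n - 1 ∧ k + n - 1 ≤ s + n - 2) := by
      omega
    by_cases hA : A <;> simp only [h1, h2, hA] <;> rfl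
  · have h1 : (1 ≤ k ∧ k ≤ 2 * n - 2) ∧ ¬(s ≤ k ∧ k ≤ s + n - 2) := by omega
    have h2 : ¬ ((1 ≤ k + n - 1 ∧ k + n - 1 ≤ 2 * n - 2) ∧
      ¬(s ≤ k + n - 1 ∧ k + n - 1 ≤ s + n - 2)) := by omega
    by_cases hA : A <;> simp only [h1, h2, hA] <;> rfl

theorem hits_exchange (hn : 4 ≤ n) (hk : k ∈ Icc 1 (n - 1)) (A : Prop) {p : ℕ}
    (hp : p ∈ Icc 1 (n - 1)) (hpk : p ≠ k) :
    ∃ H q, (q = p ∨ q = p + n - 1) ∧ H ⊆ Icc 1 (2 * n - 2) ∧ H.card = n - 1 ∧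
      (dep n H).card + hits n k A H = 2 ∧
      ((k + n - 1 ∈ H ∧ q ∉ H ∧ (dep n (insert q (H.erase (k + n - 1)))).card +
          hits n k A (insert q (H.erase (k + n - 1))) = 2) ∨
        (q ∈ H ∧ k + n - 1 ∉ H ∧ (dep n (insert (k + n - 1) (H.erase q))).card +
          hits n k A (insert (k + n - 1) (H.erase q)) = 2)) := by
  have hk' := Finset.mem_Icc.1 hk
  rw [Finset.mem_Icc] at hp
  by_cases hA : A
  · have hs : k ∈ Icc 1 n := Finset.mem_Icc.2 (by omega)
    obtain ⟨q, hq, hq1, hq2⟩ : ∃ q, (q = p ∨ q = p + n - 1) ∧ k < q ∧ q < k + n - 1 := by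
      rcases lt_or_gt_of_ne hpk with h | h
      · exact ⟨p + n - 1, Or.inr rfl, by omega, by omega⟩
      · exact ⟨p, Or.inl rfl, by omega, by omega⟩
    refine ⟨blk n k, q, hq, blk_subset, card_blk hn hs, hits_blk hn hk A hs, Or.inl ⟨?_, ?_, ?_⟩⟩
    · rw [mem_blk]; omega
    · rw [mem_blk]; omega
    · have hd : dep n (insert q ((blk n k).erase (k + n - 1))) = {k - 1, q} := by
        ext r
        simp only [mem_dep, Finset.mem_insert, Finset.mem_erase, mem_blk, Finset.mem_singleton]
        omega
      rw [hd, Finset.card_pair (by omega), hits, if_neg, if_neg]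
      · simp only [Finset.mem_insert, Finset.mem_erase, mem_blk, hA, iff_true]; omega
      · simp only [Finset.mem_insert, Finset.mem_erase, mem_blk, hA, iff_true]; omega
  · have hs : k + 1 ∈ Icc 1 n := Finset.mem_Icc.2 (by omega)
    obtain ⟨q, hq, hq1, hq2⟩ : ∃ q, (q = p ∨ q = p + n - 1) ∧ (q < k ∨ k + n - 1 < q) ∧
        q ∈ Icc 1 (2 * n - 2) := by
      simp only [Finset.mem_Icc]
      rcases lt_or_gt_of_ne hpk with h | h
      · exact ⟨p, Or.inl rfl, by omega, by omega⟩
      · exact ⟨p + n - 1, Or.inr rfl, by omega, by omega⟩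
    rw [Finset.mem_Icc] at hq2
    refine ⟨blk n (k + 1), q, hq, blk_subset, card_blk hn hs, hits_blk hn hk A hs,
      Or.inr ⟨?_, ?_, ?_⟩⟩
    · rw [mem_blk]; omega
    · rw [mem_blk]; omega
    · have hd : dep n (insert (k + n - 1) ((blk n (k + 1)).erase q)) = {k, q - 1} := by
        ext r
        simp only [mem_dep, Finset.mem_insert, Finset.mem_erase, mem_blk, Finset.mem_singleton]
        omega
      rw [hd, Finset.card_pair (by omega), hits, if_neg, if_neg]
      · simp [hA]
      · simp only [Finset.mem_insert, Finset.mem_erase, mem_blk, hA, iff_false]; omega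

end Hits

section NoTravel

variable {n t s i j q : ℕ} {T : Set (ℕ × ℕ × ℕ)}

theorem IsTournament.travel_to_eq_zero (hT : IsTournament n T) (h : (q, j, s) ∈ T)
    (hv : venue T s (q - 1) ≠ i) : travel n T (s, i, j) = 0 := by
  refine if_neg ?_
  rintro ⟨r, hr, h1, h2⟩
  simp only at h1 h2
  obtain ⟨-, hj, hs, hjs⟩ := hT.mem_Icc h
  have hr1 : r + 1 ∈ Icc 1 (2 * n - 2) := by
    by_contra hn
    exact hjs (h2.symm.trans (hT.venue_of_notMem hn))
  have hm := hT.mem_away hs hr1 fun hh => hjs (h2.symm.trans (hT.venue_home hh))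
  rw [h2] at hm
  rw [Finset.mem_Icc] at hj hs
  have := (hT.pair j s hj.1 hj.2 hs.1 hs.2 hjs).unique h hm
  rw [this] at hv
  exact hv h1

theorem IsTournament.travel_from_eq_zero (hT : IsTournament n T) (h : (q, i, s) ∈ T)
    (hv : venue T s (q + 1) ≠ j) : travel n T (s, i, j) = 0 := by
  refine if_neg ?_
  rintro ⟨r, hr, h1, h2⟩
  simp only at h1 h2
  obtain ⟨-, hi, hs, his⟩ := hT.mem_Icc h
  have hr1 : r ∈ Icc 1 (2 * n - 2) := by
    by_contra hn
    exact his (h1.symm.trans (hT.venue_of_notMem hn))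
  have hm := hT.mem_away hs hr1 fun hh => his (h1.symm.trans (hT.venue_home hh))
  rw [h1] at hm
  rw [Finset.mem_Icc] at hi hs
  have := (hT.pair i s hi.1 hi.2 hs.1 hs.2 his).unique h hm
  rw [this] at hv
  exact hv h2

theorem exists_ne_ne (hn : 4 ≤ n) (x y z : ℕ) : ∃ w ∈ Icc 1 n, w ≠ x ∧ w ≠ y ∧ w ≠ z := by
  obtain ⟨w, hw, h⟩ := Finset.exists_mem_notMem_of_card_lt_card
    (s := {x, y, z}) (t := Icc 1 n) (by
      rw [Nat.card_Icc]
      exact Finset.card_le_three.trans_lt (by omega))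
  simp only [Finset.mem_insert, Finset.mem_singleton, not_or] at h
  exact ⟨w, hw, h⟩

variable {F : ℕ → ℕ → ℕ} {R : ℕ → ℕ → Prop}

/-- Two opponents of `s` can be prescribed in two away slots of `t` or in two home slots. -/
theorem exists_sched_opponents (hn : 4 ≤ n) (hF : OneFac n F) (hs : s ∈ Icc 1 n) {x y p q : ℕ}
    (hx : x ∈ Icc 1 n) (hy : y ∈ Icc 1 n) (hxs : x ≠ s) (hys : y ≠ s) (hxy : p = q ↔ x = y)
    (hpq : (p ∈ Icc n (2 * n - 2) ∧ q ∈ Icc n (2 * n - 2)) ∨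
      (p ∈ Icc 1 (n - 1) ∧ q ∈ Icc 1 (n - 1))) :
    ∃ σ, Sched n (blk n 1) σ ∧ F (σ p) s = x ∧ F (σ q) s = y := by
  obtain ⟨c, hc, rfl⟩ := hF.ex hs hx hxs.symm
  obtain ⟨d, hd, rfl⟩ := hF.ex hs hy hys.symm
  have hcd : p = q ↔ c = d := hxy.trans ⟨hF.uniq hc hd hs, fun h => by rw [h]⟩
  simp only [Finset.mem_Icc] at hpq
  rcases hpq with ⟨hp, hq⟩ | ⟨hp, hq⟩
  · obtain ⟨σ, hσ, h1, h2, -⟩ := exists_sched_blk hn (s := 1) (Finset.mem_Icc.2 (by omega))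
      (p := p) (p' := q) (q := 1) (q' := 1) (d := 0) (d' := 0)
      (by rw [mem_blk]; omega) (by rw [mem_blk]; omega) hc hd hcd (by omega) (by omega) (by omega)
      (by omega) (by omega)
    exact ⟨σ, hσ, by rw [h1], by rw [h2]⟩
  · obtain ⟨σ, hσ, -, -, h1, h2⟩ := exists_sched_blk hn (s := 1) (Finset.mem_Icc.2 (by omega))
      (p := n) (p' := n) (c := 0) (c' := 0) (q := p) (q' := q)
      (by rw [mem_blk]; omega) (by rw [mem_blk]; omega) (by omega) (by omega) (by omega)
      (by omega) (by omega) hc hd hcd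
    exact ⟨σ, hσ, by rw [h1], by rw [h2]⟩

theorem mem_tour_away {σ : ℕ → ℕ} (hn : 4 ≤ n) (hF : OneFac n F) (hR : Orient t R)
    (hσ : Sched n (blk n 1) σ)
    (hs : s ∈ Icc 1 n) {p x : ℕ} (hp : p ∈ Icc 1 (n - 1)) (hx : F (σ p) s = x) (h : R s x) :
    (p, x, s) ∈ tour n F R (blk n 1) σ := by
  rw [Finset.mem_Icc] at hp
  subst hx
  refine mem_tour_opponent hF hR hσ hs (Finset.mem_Icc.2 (by omega)) fun hh => ?_
  have := hh.2 h
  rw [mem_blk] at this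
  omega

theorem mem_tour_home {σ : ℕ → ℕ} (hn : 4 ≤ n) (hF : OneFac n F) (hR : Orient t R)
    (hσ : Sched n (blk n 1) σ)
    (hs : s ∈ Icc 1 n) {p x : ℕ} (hp : p ∈ Icc n (2 * n - 2)) (hx : F (σ p) s = x) (h : R x s) :
    (p, x, s) ∈ tour n F R (blk n 1) σ := by
  rw [Finset.mem_Icc] at hp
  have hp' : p ∈ Icc 1 (2 * n - 2) := Finset.mem_Icc.2 (by omega)
  have hne := hF.ne (hσ.lt hp') hs
  subst hx
  refine mem_tour_opponent hF hR hσ hs hp' fun hh => (hR.tot hne).1 h (hh.1 ?_)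
  rw [mem_blk]
  omega

theorem exists_tour_travel_eq_zero (hn : 4 ≤ n) (hF : OneFac n F) (ht : t ∈ Icc 1 n)
    (hs : s ∈ Icc 1 n) (hi : i ∈ Icc 1 n) (hj : j ∈ Icc 1 n) (hij : i ≠ j)
    (h : ¬(s = t ∧ i = t)) :
    ∃ R σ, Orient t R ∧ Sched n (blk n 1) σ ∧ travel n (tour n F R (blk n 1) σ) (s, i, j) = 0 := by
  have m1 : 1 ∈ Icc 1 (n - 1) := Finset.mem_Icc.2 (by omega)
  have m2 : 2 ∈ Icc 1 (n - 1) := Finset.mem_Icc.2 (by omega)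
  have mn : n ∈ Icc n (2 * n - 2) := Finset.mem_Icc.2 (by omega)
  have mn1 : n + 1 ∈ Icc n (2 * n - 2) := Finset.mem_Icc.2 (by omega)
  have ml : 2 * n - 2 ∈ Icc n (2 * n - 2) := Finset.mem_Icc.2 (by omega)
  have first : ∀ {x}, x ≠ s → x ≠ t → rk t s 0 s < rk t s 0 x := by
    intro x hx hxt
    simp only [rk]
    split_ifs <;> omega
  have second : ∀ {x}, x ≠ t → x ≠ s → s ≠ t → rk t x s x < rk t x s s := by
    intro x hx hxt hst
    simp only [rk]
    split_ifs <;> omega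
  by_cases his : i = s
  · subst his
    by_cases hjt : j = t
    · subst hjt
      obtain ⟨w, hw, hwt, hws, -⟩ := exists_ne_ne hn j i 0
      obtain ⟨σ, hσ, h1, h2⟩ := exists_sched_opponents hn hF hs (p := n) (q := n + 1) hw hj hws
        hij.symm (by omega) (Or.inl ⟨mn, mn1⟩)
      have hR := orient_rk j w i
      have hT := isTournament_tour hF hR hσ
      refine ⟨_, σ, hR, hσ, hT.travel_to_eq_zero (q := n + 1)
        (mem_tour_home hn hF hR hσ hs mn1 h2 (hR.top hij)) ?_⟩
      rw [Nat.add_sub_cancel, hT.venue_eq (mem_tour_home hn hF hR hσ hs mn h1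
        (second hwt hws hij)) (Or.inr rfl)]
      exact hws
    · obtain ⟨w, hw, hwt, hws, hwj⟩ := exists_ne_ne hn t i j
      obtain ⟨σ, hσ, h1, h2⟩ := exists_sched_opponents hn hF hs (p := 1) (q := 2) hw hj hws
        hij.symm (by omega) (Or.inr ⟨m1, m2⟩)
      have hR := orient_rk t i 0
      have hT := isTournament_tour hF hR hσ
      refine ⟨_, σ, hR, hσ, hT.travel_to_eq_zero (q := 2)
        (mem_tour_away hn hF hR hσ hs m2 h2 (first hij.symm hjt)) ?_⟩
      rw [hT.venue_eq (mem_tour_away hn hF hR hσ hs m1 h1 (first hws hwt)) (Or.inr rfl)]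
      exact hws
  by_cases hjs : j ≠ s ∧ j ≠ t
  · obtain ⟨hjs, hjt⟩ := hjs
    obtain ⟨σ, hσ, h1, -⟩ := exists_sched_opponents hn hF hs (p := 1) (q := 1) hj hj hjs hjs
      (by omega) (Or.inr ⟨m1, m1⟩)
    have hR := orient_rk t s 0
    have hT := isTournament_tour hF hR hσ
    refine ⟨_, σ, hR, hσ, hT.travel_to_eq_zero (q := 1)
      (mem_tour_away hn hF hR hσ hs m1 h1 (first hjs hjt)) ?_⟩
    rw [hT.venue_of_notMem (by simp)]
    exact Ne.symm his
  by_cases hjt : j = t ∧ s ≠ t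
  · obtain ⟨rfl, hst⟩ := hjt
    obtain ⟨σ, hσ, h1, -⟩ := exists_sched_opponents hn hF hs (p := 2 * n - 2) (q := 2 * n - 2) hi hi
      his his (by omega) (Or.inl ⟨ml, ml⟩)
    have hR := orient_rk j i s
    have hT := isTournament_tour hF hR hσ
    refine ⟨_, σ, hR, hσ, hT.travel_from_eq_zero (q := 2 * n - 2)
      (mem_tour_home hn hF hR hσ hs ml h1 (second hij his hst)) ?_⟩
    rw [hT.venue_of_notMem (by simp)]
    exact hst
  obtain rfl : j = s := by
    by_contra hc
    exact hjt ⟨by tauto, fun e => hjs ⟨hc, e ▸ hc⟩⟩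
  by_cases hit : i = t
  · subst hit
    have hst : j ≠ i := Ne.symm hij
    obtain ⟨w, hw, hwt, hws, -⟩ := exists_ne_ne hn i j 0
    obtain ⟨σ, hσ, h1, h2⟩ := exists_sched_opponents hn hF hs (p := n) (q := n + 1) hi hw hij
      hws (by omega) (Or.inl ⟨mn, mn1⟩)
    have hR := orient_rk i w j
    have hT := isTournament_tour hF hR hσ
    refine ⟨_, σ, hR, hσ, hT.travel_from_eq_zero (q := n)
      (mem_tour_home hn hF hR hσ hs mn h1 (hR.top hst)) ?_⟩
    rw [hT.venue_eq (mem_tour_home hn hF hR hσ hs mn1 h2 (second hwt hws hst)) (Or.inr rfl)]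
    exact hws
  · obtain ⟨w, hw, hwt, hws, hwi⟩ := exists_ne_ne hn t j i
    obtain ⟨σ, hσ, h1, h2⟩ := exists_sched_opponents hn hF hs (p := 1) (q := 2) hi hw his hws
      (by omega) (Or.inr ⟨m1, m2⟩)
    have hR := orient_rk t j 0
    have hT := isTournament_tour hF hR hσ
    refine ⟨_, σ, hR, hσ, hT.travel_from_eq_zero (q := 1)
      (mem_tour_away hn hF hR hσ hs m1 h1 (first his hit)) ?_⟩
    rw [hT.venue_eq (mem_tour_away hn hF hR hσ hs m2 h2 (first hws hwt)) (Or.inr rfl)]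
    exact hws

end NoTravel

/-- The point with play vector `χ(T)` and travel coordinates `y`. -/
noncomputable def point (n : ℕ) (T : Set (ℕ × ℕ × ℕ)) (y : ℕ × ℕ × ℕ → ℝ) : Pt n :=
  (fun m => play T m.1, fun q => y q.1)

theorem travel_eq_zero_or_one (n : ℕ) (T : Set (ℕ × ℕ × ℕ)) (p : ℕ × ℕ × ℕ) :
    travel n T p = 0 ∨ travel n T p = 1 := by
  rw [travel]
  split_ifs
  · exact Or.inr rfl
  · exact Or.inl rfl

theorem point_mem_generators {n : ℕ} {T : Set (ℕ × ℕ × ℕ)} (hT : IsTournament n T)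
    {y : ℕ × ℕ × ℕ → ℝ} (hy : ∀ p, y p = 0 ∨ y p = 1) (hle : ∀ p, travel n T p ≤ y p) :
    point n T y ∈ generators n :=
  ⟨T, hT, fun _ => rfl, fun p => hy p.1, fun p => hle p.1⟩

theorem isTravelIdx_of_mem {n s i j : ℕ} (hs : s ∈ Icc 1 n) (hi : i ∈ Icc 1 n) (hj : j ∈ Icc 1 n)
    (hij : i ≠ j) : IsTravelIdx n (s, i, j) := by
  rw [Finset.mem_Icc] at hs hi hj
  exact ⟨hs.1, hs.2, hi.1, hi.2, hj.1, hj.2, hij⟩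

theorem yval_of_mem {n s i j : ℕ} (hs : s ∈ Icc 1 n) (hi : i ∈ Icc 1 n) (hj : j ∈ Icc 1 n)
    (hij : i ≠ j) (z : Pt n) : yval z s i j = z.2 ⟨(s, i, j), isTravelIdx_of_mem hs hi hj hij⟩ :=
  dif_pos _

theorem sum_yval_point {n t : ℕ} (ht : t ∈ Icc 1 n) (T : Set (ℕ × ℕ × ℕ)) (y : ℕ × ℕ × ℕ → ℝ)
    (b : ℕ → ℝ) : ∑ j ∈ Icc 1 n \ {t}, yval (point n T y) t t j * b j =
      ∑ j ∈ Icc 1 n \ {t}, y (t, t, j) * b j := by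
  refine Finset.sum_congr rfl fun j hj => ?_
  rw [Finset.mem_sdiff, Finset.mem_singleton] at hj
  rw [yval_of_mem ht ht hj.1 (Ne.symm hj.2)]
  rfl

section Facet

variable {n t k : ℕ}

theorem two_le_of_hits (hn : 4 ≤ n) (ht : t ∈ Icc 1 n) (hk : k ∈ Icc 1 (n - 1)) (A : Prop)
    {f : Pt n → ℝ} (hf : IsLinearMap ℝ f)
    (hfG : ∀ T z, IsTournament n T → (∀ m, z.1 m = play T m.1) →
      f z = ∑ j ∈ Icc 1 n \ {t}, yval z t t j + hits n k A (homeSlots n T t)) :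
    ∀ z ∈ Ptt n, 2 ≤ f z := by
  refine fun z hz => convexHull_min ?_ (convex_halfSpace_ge hf 2) hz
  rintro z ⟨T, hT, hz, -, hle⟩
  show 2 ≤ f z
  rw [hfG T z hT hz]
  have h1 : ∑ j ∈ Icc 1 n \ {t}, travel n T (t, t, j) ≤ ∑ j ∈ Icc 1 n \ {t}, yval z t t j := by
    refine Finset.sum_le_sum fun j hj => ?_
    rw [Finset.mem_sdiff, Finset.mem_singleton] at hj
    rw [yval_of_mem ht ht hj.1 (Ne.symm hj.2)]
    exact hle ⟨(t, t, j), _⟩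
  have h2 := hT.sum_travel ht fun _ => 1
  simp only [mul_one, Finset.sum_const, nsmul_eq_mul] at h2
  have h3 : (2 : ℝ) ≤ _ := Nat.cast_le.2
    (two_le_hits hn hk A (Finset.filter_subset _ _) (card_homeSlots hT ht))
  push_cast at h3
  change (2 : ℝ) ≤ (dep n (homeSlots n T t)).card + (hits n k A (homeSlots n T t) : ℝ) at h3
  linarith

theorem isFacetGE_of_hits (hn : 4 ≤ n) (he : Even n) (ht : t ∈ Icc 1 n) (hk : k ∈ Icc 1 (n - 1))
    (A : Prop) {f : Pt n → ℝ} (hf : IsLinearMap ℝ f)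
    (hfG : ∀ T z, IsTournament n T → (∀ m, z.1 m = play T m.1) →
      f z = ∑ j ∈ Icc 1 n \ {t}, yval z t t j + hits n k A (homeSlots n T t)) :
    IsFacetGE f 2 := by
  refine ⟨two_le_of_hits hn ht hk A hf hfG, ?_⟩
  have hF := oneFac_canonFac hn he
  have h1n : 1 ∈ Icc 1 n := Finset.mem_Icc.2 (by omega)
  set Good : Finset ℕ → Prop := fun H => (dep n H).card + hits n k A H = 2
  have hA : ∀ s ∈ Icc 1 n, Good (blk n s) := fun s hs => hits_blk hn hk A hs
  have hsum : ∀ T y, ∑ j ∈ Icc 1 n \ {t}, yval (point n T y) t t j =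
      ∑ j ∈ Icc 1 n \ {t}, y (t, t, j) := fun T y => by
    have := sum_yval_point (n := n) ht T y fun _ => 1
    simpa only [mul_one] using this
  have hmem : ∀ {F R H σ y}, OneFac n F → Orient t R → Sched n H σ → Good H →
      (∀ p, y p = 0 ∨ y p = 1) → (∀ p, travel n (tour n F R H σ) p ≤ y p) →
      (∀ j, y (t, t, j) = travel n (tour n F R H σ) (t, t, j)) →
      point n (tour n F R H σ) y ∈ {z ∈ Ptt n | f z = 2} := by
    intro F R H σ y hF hR hσ hG hy hle hyt
    have hT := isTournament_tour hF hR hσ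
    refine ⟨subset_convexHull ℝ _ (point_mem_generators hT hy hle), ?_⟩
    rw [hfG _ _ hT fun _ => rfl, hsum, homeSlots_tour hF hR hσ ht]
    simp only [hyt]
    have h2 := sum_travel_tour hF hR hσ ht fun _ => 1
    simp only [mul_one, Finset.sum_const, nsmul_eq_mul] at h2
    rw [h2]
    exact_mod_cast hG
  have hψ : ∀ {F R H σ}, OneFac n F → Orient t R → Sched n H σ → Good H →
      point n (tour n F R H σ) (travel n (tour n F R H σ)) ∈ {z ∈ Ptt n | f z = 2} :=
    fun hF hR hσ hG => hmem hF hR hσ hG (travel_eq_zero_or_one n _) (fun _ => le_rfl) fun _ => rfl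
  obtain ⟨σ₀, hσ₀, -⟩ := exists_sched_opponents hn hF ht (p := 1) (q := 1)
    (hF.mem (c := 0) (by omega) ht) (hF.mem (c := 0) (by omega) ht) (hF.ne (by omega) ht)
    (hF.ne (by omega) ht) (by simp) (Or.inr (by simp only [Finset.mem_Icc]; omega))
  have hR₀ := orient_rk t 0 0
  have hT₀ := isTournament_tour hF hR₀ hσ₀
  have hz₀ := hψ hF hR₀ hσ₀ (hA 1 h1n)
  set T₀ := tour n (canonFac n) (fun x y => rk t 0 0 x < rk t 0 0 y) (blk n 1) σ₀
  obtain ⟨j₀, hj₀, hj₀t, -⟩ := exists_ne_ne hn t 0 0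
  have hone : point n T₀ (fun _ => 1) ∈ Ptt n :=
    subset_convexHull ℝ _ (point_mem_generators hT₀ (fun _ => Or.inr rfl) fun p => by
      rcases travel_eq_zero_or_one n T₀ p with h | h <;> simp [h])
  refine adim_face (G := generators n) rfl (fun z hz => hz.1) (hf.mk' f) 2 (fun z hz => hz.2)
    (travelVec n (t, t, j₀)) hz₀.1 hone ?_ ?_
  · show f _ ≠ f _
    rw [hz₀.2, hfG _ _ hT₀ fun _ => rfl, hsum, Finset.sum_const, Finset.sdiff_singleton_eq_erase,
      Finset.card_erase_of_mem ht, Nat.card_Icc, nsmul_eq_mul, mul_one]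
    have : 2 ≠ (n + 1 - 1 - 1) + hits n k A (homeSlots n T₀ t) := by omega
    exact_mod_cast this
  intro ℓ hv hℓ
  have hb : ∀ s ∈ Icc 1 n, ∀ i ∈ Icc 1 n, ∀ j ∈ Icc 1 n, i ≠ j → ¬(s = t ∧ i = t) →
      ℓ (travelVec n (s, i, j)) = 0 := by
    intro s hs i hi j hj hij hst
    obtain ⟨R, σ, hR, hσ, h0⟩ := exists_tour_travel_eq_zero hn hF ht hs hi hj hij hst
    set T := tour n (canonFac n) R (blk n 1) σ with hTdef
    have hz := hψ hF hR hσ (hA 1 h1n)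
    have hz' : point n T (fun p => travel n T p + if p = (s, i, j) then 1 else 0) ∈
        {z ∈ Ptt n | f z = 2} := by
      refine hmem hF hR hσ (hA 1 h1n) (fun p => ?_) (fun p => ?_) fun j' => ?_
      · split_ifs with h
        · rw [h, h0]; norm_num
        · rw [add_zero]; exact travel_eq_zero_or_one n _ p
      · split_ifs <;> simp [hTdef]
      · rw [if_neg, add_zero]
        intro h
        simp only [Prod.mk.injEq] at h
        exact hst ⟨h.1.symm, h.2.1.symm⟩
    have hadd : point n T (fun p => travel n T p + if p = (s, i, j) then 1 else 0) =
        point n T (travel n T) + travelVec n (s, i, j) :=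
      Prod.ext (funext fun q => by simp [point, travelVec]) rfl
    have := hℓ _ hz' _ hz
    rwa [hadd, map_add, add_eq_left] at this
  set a : ℕ → ℕ → ℕ → ℝ := fun p i j => ℓ (playVec n (p, i, j))
  have hK : ∀ F R H σ, OneFac n F → Orient t R → Sched n H σ → Good H →
      total n a (tour n F R H σ) + ∑ r ∈ dep n H, ℓ (travelVec n (t, t, F (σ (r + 1)) t)) =
        ℓ (point n T₀ (travel n T₀)) := by
    intro F R H σ hF hR hσ hG
    rw [← hℓ _ (hψ hF hR hσ hG) _ hz₀, apply_generator ht ℓ hb (isTournament_tour hF hR hσ)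
      fun _ => rfl, sum_yval_point ht]
    rw [sum_travel_tour hF hR hσ ht fun j => ℓ (travelVec n (t, t, j))]
  have hzero : ∀ j ∈ Icc 1 n, j ≠ t → ℓ (travelVec n (t, t, j)) = 0 := fun j hj hjt =>
    (b_const (b := fun j => ℓ (travelVec n (t, t, j))) hn he ht hA hK j hj j₀ hj₀ hjt hj₀t).trans hv
  obtain ⟨μ, Λ, hform⟩   := exists_form (a := a) (C := ℓ (point n T₀ (travel n T₀)))
    hn he ht hk hA (fun p hp hpk => hits_exchange hn hk A hp hpk)
    fun F R H σ hF hR hσ hG => by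
      rw [← hK F R H σ hF hR hσ hG, Finset.sum_eq_zero, add_zero]
      intro r hr
      rw [mem_dep] at hr
      have hc := hσ.lt (p := r + 1) (Finset.mem_Icc.2 (by omega))
      exact hzero _ (hF.mem hc ht) (hF.ne hc ht)
  have hconst : ∀ z ∈ generators n, ℓ z = ∑ i ∈ Icc 1 n, ∑ j ∈ Icc 1 n, (if i ≠ j then μ i j else 0) +
      ∑ p ∈ Icc 1 (2 * n - 2), ∑ s ∈ Icc 1 n, Λ p s := by
    rintro z ⟨T, hT, hz, -⟩
    rw [apply_generator ht ℓ hb hT hz, ← total_eq_of_form hform hT, add_eq_left]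
    refine Finset.sum_eq_zero fun j hj => ?_
    rw [Finset.mem_sdiff, Finset.mem_singleton] at hj
    rw [hzero j hj.1 hj.2, mul_zero]
  exact fun x hx y hy => (hconst x hx).trans (hconst y hy).symm

end Facet

/-- Reversal of the order of the slots. -/
def revMatch (n : ℕ) (m : {m : ℕ × ℕ × ℕ // IsMatch n m}) : {m : ℕ × ℕ × ℕ // IsMatch n m} :=
  ⟨(2 * n - 1 - m.1.1, m.1.2), by
    obtain ⟨h1, h2, h3⟩ := m.2
    exact ⟨by show 1 ≤ 2 * n - 1 - m.1.1; omega, by show 2 * n - 1 - m.1.1 ≤ _; omega, h3⟩⟩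

/-- Reversal of the direction of travel. -/
def revTravel (n : ℕ) (p : {p : ℕ × ℕ × ℕ // IsTravelIdx n p}) :
    {p : ℕ × ℕ × ℕ // IsTravelIdx n p} :=
  ⟨(p.1.1, p.1.2.2, p.1.2.1), by
    obtain ⟨h1, h2, h3, h4, h5, h6, h7⟩ := p.2
    exact ⟨h1, h2, h5, h6, h3, h4, Ne.symm h7⟩⟩

theorem revMatch_involutive (n : ℕ) : Function.Involutive (revMatch n) := by
  rintro ⟨⟨p, m⟩, hp⟩
  refine Subtype.ext (Prod.ext ?_ rfl)
  obtain ⟨h1, h2, -⟩ := hp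
  simp only at h1 h2
  show 2 * n - 1 - (2 * n - 1 - p) = p
  omega

theorem revTravel_involutive (n : ℕ) : Function.Involutive (revTravel n) := fun _ => rfl

/-- Time reversal of points. -/
noncomputable def rev (n : ℕ) : Pt n ≃ₗ[ℝ] Pt n :=
  (LinearEquiv.funCongrLeft ℝ ℝ (revMatch_involutive n).toPerm).prodCongr
    (LinearEquiv.funCongrLeft ℝ ℝ (revTravel_involutive n).toPerm)

theorem rev_fst {n : ℕ} (z : Pt n) (m) : (rev n z).1 m = z.1 (revMatch n m) := rfl

theorem rev_snd {n : ℕ} (z : Pt n) (p) : (rev n z).2 p = z.2 (revTravel n p) := rfl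

theorem rev_rev {n : ℕ} (z : Pt n) : rev n (rev n z) = z :=
  Prod.ext (funext fun m => by rw [rev_fst, rev_fst, revMatch_involutive])
    (funext fun p => by rw [rev_snd, rev_snd, revTravel_involutive])

/-- The tournament played in reversed order. -/
def revTournament (n : ℕ) (T : Set (ℕ × ℕ × ℕ)) : Set (ℕ × ℕ × ℕ) :=
  {m | (2 * n - 1 - m.1, m.2) ∈ T}

theorem isTournament_revTournament {n : ℕ} {T : Set (ℕ × ℕ × ℕ)} (hT : IsTournament n T) :
    IsTournament n (revTournament n T) := by
  refine ⟨?_, ?_, ?_⟩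
  · rintro ⟨p, m⟩ hm
    obtain ⟨h1, h2, h3⟩ := hT.subset _ hm
    simp only at h1 h2
    exact ⟨by show 1 ≤ p; omega, by show p ≤ _; omega, h3⟩
  · intro p hp1 hp2 s hs1 hs2
    obtain ⟨⟨q, m⟩, ⟨hm, hq, hs⟩, hu⟩ := hT.slot_team (2 * n - 1 - p) (by omega) (by omega) s hs1 hs2
    simp only at hq hs
    subst hq
    refine ⟨(p, m), ⟨hm, rfl, hs⟩, ?_⟩
    rintro ⟨q, m'⟩ ⟨hm', rfl, hs'⟩
    have := hu (2 * n - 1 - q, m') ⟨hm', rfl, hs'⟩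
    simpa using this
  · intro i j hi1 hi2 hj1 hj2 hij
    obtain ⟨p, hp, hu⟩ := hT.pair i j hi1 hi2 hj1 hj2 hij
    obtain ⟨h1, h2, -⟩ := hT.subset _ hp
    simp only at h1 h2
    refine ⟨2 * n - 1 - p, ?_, fun q hq => ?_⟩
    · show (2 * n - 1 - (2 * n - 1 - p), i, j) ∈ T
      rwa [Nat.sub_sub_self (by omega)]
    · have := hu _ hq
      omega

theorem travel_revTournament (n : ℕ) (hn : 1 ≤ n) (T : Set (ℕ × ℕ × ℕ)) (s i j : ℕ) :
    travel n (revTournament n T) (s, i, j) = travel n T (s, j, i) := by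
  have hv : ∀ p, venue (revTournament n T) s p = venue T s (2 * n - 1 - p) := fun p => rfl
  unfold travel
  simp only [hv]
  refine if_congr ⟨?_, ?_⟩ rfl rfl
  · rintro ⟨r, hr, h1, h2⟩
    refine ⟨2 * n - 1 - (r + 1), by omega, h2, ?_⟩
    rwa [show 2 * n - 1 - (r + 1) + 1 = 2 * n - 1 - r by omega]
  · rintro ⟨r, hr, h1, h2⟩
    refine ⟨2 * n - 1 - (r + 1), by omega, ?_, ?_⟩
    · rwa [show 2 * n - 1 - (2 * n - 1 - (r + 1)) = r + 1 by omega]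
    · rwa [show 2 * n - 1 - (2 * n - 1 - (r + 1) + 1) = r by omega]

theorem rev_mem_generators {n : ℕ} (hn : 1 ≤ n) {z : Pt n} (hz : z ∈ generators n) :
    rev n z ∈ generators n := by
  obtain ⟨T, hT, h1, h2, h3⟩ := hz
  refine ⟨revTournament n T, isTournament_revTournament hT, fun m => ?_, fun p => ?_, fun p => ?_⟩
  · rw [rev_fst, h1]
    rfl
  · rw [rev_snd]
    exact h2 _
  · rw [rev_snd]
    exact (travel_revTournament n hn T _ _ _).trans_le (h3 (revTravel n p))

theorem rev_mem_Ptt {n : ℕ} (hn : 1 ≤ n) {z : Pt n} (hz : z ∈ Ptt n) : rev n z ∈ Ptt n := by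
  have h : rev n z ∈ rev n '' convexHull ℝ (generators n) := ⟨z, hz, rfl⟩
  rw [← LinearEquiv.coe_toLinearMap, LinearMap.image_convexHull] at h
  refine convexHull_mono ?_ h
  rintro _ ⟨x, hx, rfl⟩
  exact rev_mem_generators hn hx

theorem adim_image_rev {n : ℕ} (S : Set (Pt n)) : adim (rev n '' S) = adim S := by
  unfold adim
  rw [direction_affineSpan, direction_affineSpan]
  have := AffineMap.map_vectorSpan (rev n).toLinearMap.toAffineMap (s := S)
  have h2 : vectorSpan ℝ (rev n '' S) = (vectorSpan ℝ S).map (rev n).toLinearMap := this.symm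
  rw [h2]
  exact LinearEquiv.finrank_map_eq (rev n) _

theorem IsFacetGE.comp_rev {n : ℕ} (hn : 1 ≤ n) {f : Pt n → ℝ} {γ : ℝ} (h : IsFacetGE f γ) :
    IsFacetGE (fun z => f (rev n z)) γ := by
  refine ⟨fun z hz => h.1 _ (rev_mem_Ptt hn hz), ?_⟩
  rw [← h.2, ← adim_image_rev {z ∈ Ptt n | f z = γ}]
  congr 2
  ext z
  refine ⟨fun hz => ⟨rev n z, ⟨rev_mem_Ptt hn hz.1, hz.2⟩, rev_rev z⟩, ?_⟩
  rintro ⟨x, hx, rfl⟩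
  exact ⟨rev_mem_Ptt hn hx.1, by
    show f (rev n (rev n x)) = γ
    rw [rev_rev]
    exact hx.2⟩

theorem xval_rev {n p : ℕ} (hp : p ∈ Icc 1 (2 * n - 2)) (z : Pt n) (i j : ℕ) :
    xval (rev n z) p i j = xval z (2 * n - 1 - p) i j := by
  rw [Finset.mem_Icc] at hp
  have hiff : IsMatch n (2 * n - 1 - p, i, j) ↔ IsMatch n (p, i, j) := by
    simp only [IsMatch]
    omega
  unfold xval
  by_cases h : IsMatch n (p, i, j)
  · rw [dif_pos h, dif_pos (hiff.2 h), rev_fst]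
    rfl
  · rw [dif_neg h, dif_neg fun h' => h (hiff.1 h')]

theorem yval_rev {n : ℕ} (z : Pt n) (s i j : ℕ) : yval (rev n z) s i j = yval z s j i := by
  have hiff : IsTravelIdx n (s, j, i) ↔ IsTravelIdx n (s, i, j) := by
    simp only [IsTravelIdx]
    omega
  unfold yval
  by_cases h : IsTravelIdx n (s, i, j)
  · rw [dif_pos h, dif_pos (hiff.2 h), rev_snd]
    rfl
  · rw [dif_neg h, dif_neg fun h' => h (hiff.1 h')]

section Linear

variable {n : ℕ}

theorem isLinearMap_xval (k i j : ℕ) : IsLinearMap ℝ fun z : Pt n => xval z k i j := by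
  constructor <;> intros <;> unfold xval <;> split_ifs <;> simp

theorem isLinearMap_yval (t i j : ℕ) : IsLinearMap ℝ fun z : Pt n => yval z t i j := by
  constructor <;> intros <;> unfold yval <;> split_ifs <;> simp

theorem isLinearMap_sum {s : Finset ℕ} {g : ℕ → Pt n → ℝ} (hg : ∀ j, IsLinearMap ℝ (g j)) :
    IsLinearMap ℝ fun z => ∑ j ∈ s, g j z where
  map_add x y := by simp only [(hg _).map_add, Finset.sum_add_distrib]
  map_smul c x := by simp only [(hg _).map_smul, Finset.smul_sum]

theorem isLinearMap_add {f g : Pt n → ℝ} (hf : IsLinearMap ℝ f) (hg : IsLinearMap ℝ g) :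
    IsLinearMap ℝ fun z => f z + g z where
  map_add x y := by rw [hf.map_add, hg.map_add]; ring
  map_smul c x := by rw [hf.map_smul, hg.map_smul, smul_add]

end Linear

section HomeFlow

variable {n t k : ℕ}

theorem isFacetGE_home (hn : 4 ≤ n) (he : Even n) (ht : t ∈ Icc 1 n) (hk : k ∈ Icc 1 (n - 1)) :
    IsFacetGE (fun z : Pt n =>
      (∑ j ∈ Icc 1 n \ {t}, yval z t t j) +
        ∑ j ∈ Icc 1 n \ {t}, (xval z k t j + xval z (k + n - 1) t j)) 2 := by
  refine isFacetGE_of_hits hn he ht hk True (isLinearMap_add (isLinearMap_sum fun j =>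
    isLinearMap_yval t t j) (isLinearMap_sum fun j => isLinearMap_add (isLinearMap_xval k t j)
      (isLinearMap_xval (k + n - 1) t j))) fun T z hT hz => ?_
  rw [Finset.sum_add_distrib, sum_xval_home hT hz, sum_xval_home hT hz, hits]
  simp only [iff_true]
  push_cast
  congr

theorem isFacetGE_away (hn : 4 ≤ n) (he : Even n) (ht : t ∈ Icc 1 n) (hk : k ∈ Icc 1 (n - 1)) :
    IsFacetGE (fun z : Pt n =>
      (∑ j ∈ Icc 1 n \ {t}, yval z t t j) +
        ∑ j ∈ Icc 1 n \ {t}, (xval z k j t + xval z (k + n - 1) j t)) 2 := by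
  refine isFacetGE_of_hits hn he ht hk False (isLinearMap_add (isLinearMap_sum fun j =>
    isLinearMap_yval t t j) (isLinearMap_sum fun j => isLinearMap_add (isLinearMap_xval k j t)
      (isLinearMap_xval (k + n - 1) j t))) fun T z hT hz => ?_
  rw [Finset.mem_Icc] at hk
  rw [Finset.sum_add_distrib, sum_xval_away hT hz ht (Finset.mem_Icc.2 (by omega)),
    sum_xval_away hT hz ht (Finset.mem_Icc.2 (by omega)), hits]
  simp only [iff_false]
  push_cast
  congr

end HomeFlow

/-- the four home-flow inequalities are facet-defining. -/
theorem home_flow_facet (n : ℕ) (hn : 4 ≤ n) (heven : Even n)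
    (t : ℕ) (ht1 : 1 ≤ t) (htn : t ≤ n)
    (k : ℕ) (hk1 : 1 ≤ k) (hk2 : k ≤ n - 1) :
    IsFacetGE (fun z : Pt n =>
      (∑ j ∈ Finset.Icc 1 n \ {t}, yval z t t j) +
        ∑ j ∈ Finset.Icc 1 n \ {t}, (xval z k t j + xval z (k + n - 1) t j)) 2 ∧
    IsFacetGE (fun z : Pt n =>
      (∑ j ∈ Finset.Icc 1 n \ {t}, yval z t t j) +
        ∑ j ∈ Finset.Icc 1 n \ {t}, (xval z k j t + xval z (k + n - 1) j t)) 2 ∧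
    IsFacetGE (fun z : Pt n =>
      (∑ i ∈ Finset.Icc 1 n \ {t}, yval z t i t) +
        ∑ i ∈ Finset.Icc 1 n \ {t}, (xval z k t i + xval z (k + n - 1) t i)) 2 ∧
    IsFacetGE (fun z : Pt n =>
      (∑ i ∈ Finset.Icc 1 n \ {t}, yval z t i t) +
        ∑ i ∈ Finset.Icc 1 n \ {t}, (xval z k i t + xval z (k + n - 1) i t)) 2 := by
  have ht : t ∈ Icc 1 n := Finset.mem_Icc.2 ⟨ht1, htn⟩
  have hk : k ∈ Icc 1 (n - 1) := Finset.mem_Icc.2 ⟨hk1, hk2⟩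
  have hk' : n - k ∈ Icc 1 (n - 1) := Finset.mem_Icc.2 (by omega)
  have h1 : ∀ (z : Pt n) i j, xval (rev n z) (n - k) i j = xval z (k + n - 1) i j := by
    intro z i j
    rw [xval_rev (Finset.mem_Icc.2 (by omega)), show 2 * n - 1 - (n - k) = k + n - 1 by omega]
  have h2 : ∀ (z : Pt n) i j, xval (rev n z) (n - k + n - 1) i j = xval z k i j := by
    intro z i j
    rw [xval_rev (Finset.mem_Icc.2 (by omega)), show 2 * n - 1 - (n - k + n - 1) = k by omega]
  have hc := (isFacetGE_home hn heven ht hk').comp_rev (by omega)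
  have hd := (isFacetGE_away hn heven ht hk').comp_rev (by omega)
  simp only [yval_rev, h1, h2] at hc hd
  refine ⟨isFacetGE_home hn heven ht hk, isFacetGE_away hn heven ht hk, ?_, ?_⟩
  · simpa only [add_comm (xval _ (k + n - 1) _ _)] using hc
  · simpa only [add_comm (xval _ (k + n - 1) _ _)] using hd

end TTP
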